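/- Let C > 0, β > 0, b > 0 and d > 0. Let Ω ⊂ ℝ² be a normalized convex domain and f ∈ 𝒮(Ω,C) satisfy PDE (1.2) with parameter β; let u be the Legendre transform function of f relative to 0, assume d + u > 0 on Ω and 1/(ρ(d+u)) < b on Ω. Then there exist positive constants α, N and m such that 𝒜 ≤ d₂ and 𝒟 ≤ d₂ for some constant d₂ > 0 depending only on α, b, β, C and d. -/

import Mathlib

open Real Filter Topology Matrix

noncomputable section

/-- The `i`-th partial derivative of `f`. -/
def pd {n : ℕ} (i : Fin n) (f : (Fin n → ℝ) → ℝ) : (Fin n → ℝ) → ℝ :=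
  fun x => fderiv ℝ f x (Pi.single i 1)

/-- The Hessian matrix `(∂²f/∂x_i∂x_j)` of `f` at `x`. -/
def hess {n : ℕ} (f : (Fin n → ℝ) → ℝ) (x : Fin n → ℝ) : Matrix (Fin n) (Fin n) ℝ :=
  Matrix.of fun i j => pd i (pd j f) x

/-- The gradient vector of `f` at `x`. -/
def gradv {n : ℕ} (f : (Fin n → ℝ) → ℝ) (x : Fin n → ℝ) : Fin n → ℝ :=
  fun i => pd i f x

/-- `ρ := (det (f_ij))^(-1/(n+2))`. -/
def rho {n : ℕ} (f : (Fin n → ℝ) → ℝ) (x : Fin n → ℝ) : ℝ :=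
  (hess f x).det ^ (-(1 : ℝ) / ((n : ℝ) + 2))

/-- The squared norm `‖grad h‖² = ∑ f^{ij} h_i h_j` with respect to the Calabi metric of `f`. -/
def gradSq {n : ℕ} (f h : (Fin n → ℝ) → ℝ) (x : Fin n → ℝ) : ℝ :=
  ∑ i, ∑ j, (hess f x)⁻¹ i j * pd i h x * pd j h x

/-- The Laplacian `Δh = (1/√det)(∑ ∂_i(√det · f^{ij} ∂_j h))` with respect to the
Calabi metric of `f`. -/
def calabiLap {n : ℕ} (f h : (Fin n → ℝ) → ℝ) (x : Fin n → ℝ) : ℝ :=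
  (Real.sqrt (hess f x).det)⁻¹ *
    ∑ i, ∑ j, pd i (fun y => Real.sqrt (hess f y).det * (hess f y)⁻¹ i j * pd j h y) x

/-- `Φ := ‖grad ρ‖²/ρ²`. -/
def Phi {n : ℕ} (f : (Fin n → ℝ) → ℝ) (x : Fin n → ℝ) : ℝ :=
  gradSq f (rho f) x / (rho f x) ^ 2

/-- PDE (1.2): `Δρ = -β ‖grad ρ‖²/ρ` on `Ω`. -/
def PDE2 {n : ℕ} (f : (Fin n → ℝ) → ℝ) (β : ℝ) (Ω : Set (Fin n → ℝ)) : Prop :=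
  ∀ x ∈ Ω, calabiLap f (rho f) x = -β * gradSq f (rho f) x / rho f x

/-- The cofactor matrix of a square matrix. -/
def cof {n : ℕ} (H : Matrix (Fin n) (Fin n) ℝ) : Matrix (Fin n) (Fin n) ℝ :=
  (Matrix.adjugate H)ᵀ

/-- PDE (1.1): `∑ F^{ij} w_ij = 0` with `w = (det (f_ij))^a` on `Ω`, where `(F^{ij})`
is the cofactor matrix of the Hessian of `f`. -/
def PDE1 {n : ℕ} (f : (Fin n → ℝ) → ℝ) (a : ℝ) (Ω : Set (Fin n → ℝ)) : Prop :=
  ∀ x ∈ Ω, ∑ i, ∑ j,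
    cof (hess f x) i j * pd i (pd j fun y => (hess f y).det ^ a) x = 0

/-- `f` is a quadratic polynomial on `ℝ²`. -/
def IsQuadratic (f : (Fin 2 → ℝ) → ℝ) : Prop :=
  ∃ (Q : Matrix (Fin 2) (Fin 2) ℝ) (b : Fin 2 → ℝ) (c : ℝ),
    ∀ x, f x = (∑ i, ∑ j, Q i j * x i * x j) + (∑ i, b i * x i) + c

/-- Euclidean open ball of radius `r` centered at `0` in `ℝ²`. -/
def ebal (r : ℝ) : Set (Fin 2 → ℝ) := {x | (x 0) ^ 2 + (x 1) ^ 2 < r ^ 2}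

/-- Euclidean norm on `ℝ²`. -/
def enorm2 (x : Fin 2 → ℝ) : ℝ := Real.sqrt ((x 0) ^ 2 + (x 1) ^ 2)

/-- A normalized convex domain: `B_{2^{-3/2}}(0) ⊆ Ω ⊆ B_1(0)`. -/
def NormalizedDomain (Ω : Set (Fin 2 → ℝ)) : Prop :=
  IsOpen Ω ∧ Convex ℝ Ω ∧ ebal ((2 : ℝ) ^ (-(3 : ℝ) / 2)) ⊆ Ω ∧ Ω ⊆ ebal 1

/-- The class `𝒮(Ω,C)`: smooth strictly convex functions on `Ω` with `inf f = 0` and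
`f = C` on `∂Ω`. -/
def SClass (Ω : Set (Fin 2 → ℝ)) (C : ℝ) (f : (Fin 2 → ℝ) → ℝ) : Prop :=
  ContDiffOn ℝ (⊤ : ℕ∞) f Ω ∧ (∀ x ∈ Ω, (hess f x).PosDef) ∧
    sInf (f '' Ω) = 0 ∧ ContinuousOn f (closure Ω) ∧ ∀ x ∈ frontier Ω, f x = C

/-- `u` is the Legendre transform function of `f` relative to `0`:
`u(∇f(x)) = ⟨x, ∇f(x)⟩ - f(x)`. -/
def LegendreOf (Ω : Set (Fin 2 → ℝ)) (f u : (Fin 2 → ℝ) → ℝ) : Prop :=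
  ∀ x ∈ Ω, u (gradv f x) = (∑ i, x i * gradv f x i) - f x

end

/-- `𝒜 = max_Ω exp{-m/(C-f)} Φ / (ρ^α (d+u)^α)`. -/
noncomputable def Aval (Ω : Set (Fin 2 → ℝ)) (C m α d : ℝ) (f u : (Fin 2 → ℝ) → ℝ) : ℝ :=
  sSup ((fun x => Real.exp (-m / (C - f x)) * Phi f x /
    ((rho f x) ^ α * (d + u (gradv f x)) ^ α)) '' Ω)

/-- `K = (N/𝒜) exp{-m/(C-f)} Φ / (ρ^α (d+u)^α)`. -/
noncomputable def Kfun (Ω : Set (Fin 2 → ℝ)) (C m α N d : ℝ) (f u : (Fin 2 → ℝ) → ℝ)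
    (x : Fin 2 → ℝ) : ℝ :=
  N / Aval Ω C m α d f u *
    (Real.exp (-m / (C - f x)) * Phi f x / ((rho f x) ^ α * (d + u (gradv f x)) ^ α))

/-- `𝒟 = max_Ω exp{-m/(C-f)+K} g² ‖grad f‖² / (ρ^α (d+u)^α)` with `g = m/(C-f)²`. -/
noncomputable def Dval (Ω : Set (Fin 2 → ℝ)) (C m α N d : ℝ) (f u : (Fin 2 → ℝ) → ℝ) : ℝ :=
  sSup ((fun x => Real.exp (-m / (C - f x) + Kfun Ω C m α N d f u x) *
    (m / (C - f x) ^ 2) ^ 2 * gradSq f f x /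
    ((rho f x) ^ α * (d + u (gradv f x)) ^ α)) '' Ω)

/-- The directional derivative of `h` in the direction `v`. -/
noncomputable def dird (v : Fin 2 → ℝ) (h : (Fin 2 → ℝ) → ℝ) : (Fin 2 → ℝ) → ℝ :=
  fun x => fderiv ℝ h x v

section Calculus

variable {U : Set (Fin 2 → ℝ)} {φ ψ : (Fin 2 → ℝ) → ℝ} {v w x : Fin 2 → ℝ}

lemma differentiableAt_of_smoothOn (hU : IsOpen U) (hφ : ContDiffOn ℝ (⊤ : ℕ∞) φ U) (hx : x ∈ U) :
    DifferentiableAt ℝ φ x :=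
  (hφ.contDiffAt (hU.mem_nhds hx)).differentiableAt (by simp)

lemma contDiffOn_dird (hU : IsOpen U) (hφ : ContDiffOn ℝ (⊤ : ℕ∞) φ U) (v : Fin 2 → ℝ) :
    ContDiffOn ℝ (⊤ : ℕ∞) (dird v φ) U :=
  (hφ.fderiv_of_isOpen hU (by simp)).clm_apply contDiffOn_const

lemma dird_congr (hU : IsOpen U) (h : ∀ y ∈ U, φ y = ψ y) (v : Fin 2 → ℝ) (hx : x ∈ U) :
    dird v φ x = dird v ψ x := by
  have : φ =ᶠ[𝓝 x] ψ := by
    filter_upwards [hU.mem_nhds hx] with y hy using h y hy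
  simp only [dird, this.fderiv_eq]

lemma dird_mul (hφ : DifferentiableAt ℝ φ x) (hψ : DifferentiableAt ℝ ψ x) (v : Fin 2 → ℝ) :
    dird v (fun y => φ y * ψ y) x = dird v φ x * ψ x + φ x * dird v ψ x := by
  simp only [dird]
  rw [fderiv_fun_mul hφ hψ]
  simp only [_root_.add_apply, _root_.smul_apply, smul_eq_mul]
  ring

lemma dird_add (hφ : DifferentiableAt ℝ φ x) (hψ : DifferentiableAt ℝ ψ x) (v : Fin 2 → ℝ) :
    dird v (fun y => φ y + ψ y) x = dird v φ x + dird v ψ x := by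
  simp only [dird]
  rw [fderiv_fun_add hφ hψ]
  simp

lemma dird_sub (hφ : DifferentiableAt ℝ φ x) (hψ : DifferentiableAt ℝ ψ x) (v : Fin 2 → ℝ) :
    dird v (fun y => φ y - ψ y) x = dird v φ x - dird v ψ x := by
  simp only [dird]
  rw [fderiv_fun_sub hφ hψ]
  simp

lemma dird_const_mul (hφ : DifferentiableAt ℝ φ x) (c : ℝ) (v : Fin 2 → ℝ) :
    dird v (fun y => c * φ y) x = c * dird v φ x := by
  simp only [dird]
  rw [fderiv_const_mul hφ]
  simp

lemma dird_const (c : ℝ) (v : Fin 2 → ℝ) : dird v (fun _ => c) x = 0 := by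
  simp [dird]

lemma dird_comm (hU : IsOpen U) (hφ : ContDiffOn ℝ (⊤ : ℕ∞) φ U) (v w : Fin 2 → ℝ) (hx : x ∈ U) :
    dird v (dird w φ) x = dird w (dird v φ) x := by
  have h := (hφ.contDiffAt (hU.mem_nhds hx)).isSymmSndFDerivAt
    (by simpa using WithTop.coe_le_coe.2 (le_top : (2 : ℕ∞) ≤ ⊤))
  have hd : DifferentiableAt ℝ (fderiv ℝ φ) x :=
    (((hφ.fderiv_of_isOpen hU (m := (⊤ : ℕ∞)) (by simp))).contDiffAt
      (hU.mem_nhds hx)).differentiableAt (by simp)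
  have key : ∀ a b : Fin 2 → ℝ, dird a (dird b φ) x = fderiv ℝ (fderiv ℝ φ) x a b := by
    intro a b
    have e : dird b φ = fun y => fderiv ℝ φ y b := rfl
    rw [e]
    simp only [dird]
    rw [fderiv_clm_apply hd (differentiableAt_const b)]
    simp
  rw [key, key]
  exact h v w

lemma dird_dird_mul (hU : IsOpen U) (hφ : ContDiffOn ℝ (⊤ : ℕ∞) φ U)
    (hψ : ContDiffOn ℝ (⊤ : ℕ∞) ψ U) (v w : Fin 2 → ℝ) (hx : x ∈ U) :
    dird v (dird w fun y => φ y * ψ y) x = dird v (dird w φ) x * ψ x + dird w φ x * dird v ψ x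
      + dird v φ x * dird w ψ x + φ x * dird v (dird w ψ) x := by
  have d : ∀ {χ : (Fin 2 → ℝ) → ℝ}, ContDiffOn ℝ (⊤ : ℕ∞) χ U → ∀ y ∈ U, DifferentiableAt ℝ χ y :=
    fun h y hy => differentiableAt_of_smoothOn hU h hy
  have hφ' := contDiffOn_dird hU hφ w
  have hψ' := contDiffOn_dird hU hψ w
  rw [dird_congr hU (ψ := fun y => dird w φ y * ψ y + φ y * dird w ψ y)
    (fun y hy => dird_mul (d hφ y hy) (d hψ y hy) w) v hx,
    dird_add (d (hφ'.mul hψ) x hx) (d (hφ.mul hψ') x hx),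
    dird_mul (d hφ' x hx) (d hψ x hx), dird_mul (d hφ x hx) (d hψ' x hx)]
  ring

lemma dird_dird_add (hU : IsOpen U) (hφ : ContDiffOn ℝ (⊤ : ℕ∞) φ U)
    (hψ : ContDiffOn ℝ (⊤ : ℕ∞) ψ U) (v w : Fin 2 → ℝ) (hx : x ∈ U) :
    dird v (dird w fun y => φ y + ψ y) x = dird v (dird w φ) x + dird v (dird w ψ) x := by
  have d : ∀ {χ : (Fin 2 → ℝ) → ℝ}, ContDiffOn ℝ (⊤ : ℕ∞) χ U → ∀ y ∈ U, DifferentiableAt ℝ χ y :=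
    fun h y hy => differentiableAt_of_smoothOn hU h hy
  rw [dird_congr hU (ψ := fun y => dird w φ y + dird w ψ y)
    (fun y hy => dird_add (d hφ y hy) (d hψ y hy) w) v hx,
    dird_add (d (contDiffOn_dird hU hφ w) x hx) (d (contDiffOn_dird hU hψ w) x hx)]

lemma dird_dird_sub (hU : IsOpen U) (hφ : ContDiffOn ℝ (⊤ : ℕ∞) φ U)
    (hψ : ContDiffOn ℝ (⊤ : ℕ∞) ψ U) (v w : Fin 2 → ℝ) (hx : x ∈ U) :
    dird v (dird w fun y => φ y - ψ y) x = dird v (dird w φ) x - dird v (dird w ψ) x := by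
  have d : ∀ {χ : (Fin 2 → ℝ) → ℝ}, ContDiffOn ℝ (⊤ : ℕ∞) χ U → ∀ y ∈ U, DifferentiableAt ℝ χ y :=
    fun h y hy => differentiableAt_of_smoothOn hU h hy
  rw [dird_congr hU (ψ := fun y => dird w φ y - dird w ψ y)
    (fun y hy => dird_sub (d hφ y hy) (d hψ y hy) w) v hx,
    dird_sub (d (contDiffOn_dird hU hφ w) x hx) (d (contDiffOn_dird hU hψ w) x hx)]

lemma dird_log (hφ : DifferentiableAt ℝ φ x) (h0 : φ x ≠ 0) (v : Fin 2 → ℝ) :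
    φ x * dird v (fun y => Real.log (φ y)) x = dird v φ x := by
  simp only [dird]
  rw [fderiv.log hφ h0]
  simp only [_root_.smul_apply, smul_eq_mul]
  field_simp

lemma dird_dird_log (hU : IsOpen U) (hφ : ContDiffOn ℝ (⊤ : ℕ∞) φ U) (h0 : ∀ y ∈ U, φ y ≠ 0)
    (v w : Fin 2 → ℝ) (hx : x ∈ U) :
    φ x * dird v (dird w fun y => Real.log (φ y)) x =
      dird v (dird w φ) x -
        φ x * (dird v (fun y => Real.log (φ y)) x * dird w (fun y => Real.log (φ y)) x) := by
  have hl : ContDiffOn ℝ (⊤ : ℕ∞) (fun y => Real.log (φ y)) U := hφ.log h0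
  have d : ∀ {χ : (Fin 2 → ℝ) → ℝ}, ContDiffOn ℝ (⊤ : ℕ∞) χ U → ∀ y ∈ U, DifferentiableAt ℝ χ y :=
    fun h y hy => differentiableAt_of_smoothOn hU h hy
  have h1 := dird_congr hU (fun y hy => dird_log (d hφ y hy) (h0 y hy) w) v hx
  rw [dird_mul (d hφ x hx) (d (contDiffOn_dird hU hl w) x hx)] at h1
  have h2 := dird_log (d hφ x hx) (h0 x hx) v
  rw [← h1, ← h2]
  ring

lemma dird_eq_zero_of_isLocalMax (hm : IsLocalMax φ x) (v : Fin 2 → ℝ) : dird v φ x = 0 := by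
  simp [dird, hm.fderiv_eq_zero]

lemma hasDerivAt_line {t : ℝ} (hφ : DifferentiableAt ℝ φ (x + t • v)) :
    HasDerivAt (fun s : ℝ => φ (x + s • v)) (dird v φ (x + t • v)) t := by
  have h1 : HasDerivAt (fun s : ℝ => x + s • v) v t := by
    simpa using ((hasDerivAt_id t).smul_const v).const_add x
  exact hφ.hasFDerivAt.comp_hasDerivAt t h1

lemma dird_dird_nonpos_of_isLocalMax (hU : IsOpen U) (hφ : ContDiffOn ℝ (⊤ : ℕ∞) φ U) (hx : x ∈ U)
    (hm : IsLocalMax φ x) (v : Fin 2 → ℝ) : dird v (dird v φ) x ≤ 0 := by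
  by_contra! hpos
  have d : ∀ {χ : (Fin 2 → ℝ) → ℝ}, ContDiffOn ℝ (⊤ : ℕ∞) χ U → ∀ y ∈ U, DifferentiableAt ℝ χ y :=
    fun h y hy => differentiableAt_of_smoothOn hU h hy
  set L : ℝ → (Fin 2 → ℝ) := fun s => x + s • v with hL
  have hLc : Continuous L := by fun_prop
  have hL0 : L 0 = x := by simp [hL]
  have hev : ∀ᶠ s in 𝓝 (0 : ℝ), L s ∈ U :=
    hLc.continuousAt.eventually_mem (by rw [hL0]; exact hU.mem_nhds hx)
  have hd1 : deriv (φ ∘ L) =ᶠ[𝓝 0] (dird v φ ∘ L) := by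
    filter_upwards [hev] with s hs
    exact (hasDerivAt_line (d hφ _ hs)).deriv
  have hd2 : deriv (deriv (φ ∘ L)) 0 = dird v (dird v φ) x := by
    rw [hd1.deriv_eq]
    have := (hasDerivAt_line (φ := dird v φ) (x := x) (v := v) (t := 0)
      (d (contDiffOn_dird hU hφ v) _ (by simpa using hx))).deriv
    simpa [hL, Function.comp_def] using this
  have hmax : IsLocalMax (φ ∘ L) 0 := by
    have : ∀ᶠ y in 𝓝 (L 0), φ y ≤ φ x := by rw [hL0]; exact hm
    have h2 := hLc.continuousAt.eventually this
    simpa [IsLocalMax, IsMaxFilter, hL0] using h2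
  have hcont : ContinuousAt (φ ∘ L) 0 := by
    refine ContinuousAt.comp ?_ hLc.continuousAt
    rw [hL0]
    exact (d hφ x hx).continuousAt
  have hmin := isLocalMin_of_deriv_deriv_pos (by rw [hd2]; exact hpos) hmax.deriv_eq_zero hcont
  have hconst : (φ ∘ L) =ᶠ[𝓝 0] fun _ => (φ ∘ L) 0 := by
    filter_upwards [hmax, hmin] with s h1 h2 using le_antisymm h1 h2
  have h3 : deriv (φ ∘ L) =ᶠ[𝓝 0] fun _ => 0 := by
    have := hconst.deriv
    simpa using this
  have h4 := h3.deriv_eq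
  rw [hd2] at h4
  simp at h4
  exact hpos.ne' h4

end Calculus

section Inequality

lemma exists_unit_direction (p q : ℝ) :
    ∃ j e₁ e₂ : ℝ, e₁ ^ 2 + e₂ ^ 2 = 1 ∧ p = j * e₁ ∧ q = j * e₂ ∧ j ^ 2 = p ^ 2 + q ^ 2 := by
  by_cases h : p ^ 2 + q ^ 2 = 0
  · have hp : p = 0 := by nlinarith [sq_nonneg p, sq_nonneg q]
    have hq : q = 0 := by nlinarith [sq_nonneg p, sq_nonneg q]
    exact ⟨0, 1, 0, by norm_num, by simp [hp], by simp [hq], by simp [hp, hq]⟩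
  · have hpos : 0 < p ^ 2 + q ^ 2 := lt_of_le_of_ne (by positivity) (Ne.symm h)
    have hj : 0 < √(p ^ 2 + q ^ 2) := Real.sqrt_pos.2 hpos
    have hs : √(p ^ 2 + q ^ 2) ^ 2 = p ^ 2 + q ^ 2 := Real.sq_sqrt hpos.le
    refine ⟨√(p ^ 2 + q ^ 2), p / √(p ^ 2 + q ^ 2), q / √(p ^ 2 + q ^ 2), ?_, ?_, ?_, hs⟩
    · rw [div_pow, div_pow, hs, ← add_div, div_self h]
    · field_simp
    · field_simp

/-- The Bochner-type inequality for `Φ + μ n²`, `n` being the length of `∇f / (C - f)`: here `y`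
stands for `1 / (C - f)`, `p, q` for the gradient of `log ρ`, `A, B` for third derivatives of
`f`, `s, t` for the trace-free part of the Hessian of `log ρ`, and `T₁, T₂` for the
logarithmic gradient of `Φ + μ n²`. -/
lemma bochner_lower_bound {n y p q A B s t γ μ P T₁ T₂ : ℝ} (hγ : 1 ≤ γ) (hμ : 0 < μ)
    (hP : P = p ^ 2 + q ^ 2 + μ * n ^ 2) (hP0 : 0 < P) (hy : 0 ≤ y)
    (h1 : 2 * (s * p + t * q) - γ * (p ^ 2 + q ^ 2) * p
      + μ * (n * (2 * y + 2 * n ^ 2 - A * n)) = P * T₁)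
    (h2 : 2 * (t * p - s * q) - γ * (p ^ 2 + q ^ 2) * q + μ * (n * (-(B * n))) = P * T₂) :
    P * (μ * n ^ 2 * ((T₁ ^ 2 + T₂ ^ 2) / 4 - (300 + 4 * γ) * (p ^ 2 + q ^ 2)
        - (80 + 2 * μ) * n ^ 2) - 300 * μ * y ^ 2) ≤
      P * (4 * (s ^ 2 + t ^ 2) - 4 * γ * (s * (p ^ 2 - q ^ 2) + 2 * t * p * q)
          + 3 * γ ^ 2 * (p ^ 2 + q ^ 2) ^ 2
          + ((A + 3 * p) ^ 2 + (B + q) ^ 2 - (p ^ 2 + q ^ 2)) * (p ^ 2 + q ^ 2)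
          + μ * (4 * y ^ 2 + 8 * p * n * y + 12 * n ^ 2 * y + 6 * n ^ 4 - 4 * A * n ^ 3
            + n ^ 2 * (A ^ 2 + 2 * B ^ 2 + (4 * p + A) ^ 2 + 4 * s - 2 * γ * (p ^ 2 + q ^ 2)
              + 2 * A * p + 2 * B * q)
            + 2 * n * (p * (2 * y + 2 * n ^ 2 - A * n) - q * (B * n))))
        - (P * T₁) ^ 2 - (P * T₂) ^ 2 := by
  obtain ⟨j, e, k, hu, hp, hq, hj⟩ := exists_unit_direction p q
  rw [← hj] at hP h1 h2 ⊢
  obtain ⟨a, ha⟩ : ∃ a, a = 2 * y + 2 * n ^ 2 - A * n := ⟨_, rfl⟩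
  obtain ⟨b, hb⟩ : ∃ b, b = -(B * n) := ⟨_, rfl⟩
  obtain ⟨v, hv⟩ : ∃ v, v = 2 * (s * e + t * k) - γ * j ^ 2 * e := ⟨_, rfl⟩
  obtain ⟨w, hw⟩ : ∃ w, w = 2 * (t * e - s * k) - γ * j ^ 2 * k := ⟨_, rfl⟩
  obtain ⟨X, hX⟩ : ∃ X, P * X = n * v - j * a := ⟨(n * v - j * a) / P, by field_simp⟩
  obtain ⟨Y, hY⟩ : ∃ Y, P * Y = n * w - j * b := ⟨(n * w - j * b) / P, by field_simp⟩
  have g1 : P * T₁ = j * v + μ * n * a := by rw [← h1, hv, ha, hp, hq]; ring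
  have g2 : P * T₂ = j * w + μ * n * b := by rw [← h2, hw, hb, hp, hq]; ring
  have hjP : j ^ 2 ≤ P := by rw [hP]; linarith only [mul_nonneg hμ.le (sq_nonneg n)]
  have t1 : n * T₁ = a + j * X := by
    apply mul_left_cancel₀ hP0.ne'
    linear_combination n * g1 - j * hX - a * hP
  have t2 : n * T₂ = b + j * Y := by
    apply mul_left_cancel₀ hP0.ne'
    linear_combination n * g2 - j * hY - b * hP
  have eΦ : 4 * (s ^ 2 + t ^ 2) - 4 * γ * (s * (p ^ 2 - q ^ 2) + 2 * t * p * q)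
      = v ^ 2 + w ^ 2 - γ ^ 2 * (j ^ 2) ^ 2 := by
    rw [hv, hw, hp, hq]
    linear_combination (-4 * (s ^ 2 + t ^ 2) - γ ^ 2 * j ^ 4) * hu
  have eT : P * (v ^ 2 + w ^ 2 + μ * (a ^ 2 + b ^ 2)) - (P * T₁) ^ 2 - (P * T₂) ^ 2
      = P * (μ * (P * (X ^ 2 + Y ^ 2))) := by
    rw [show P * (μ * (P * (X ^ 2 + Y ^ 2))) = μ * ((P * X) ^ 2 + (P * Y) ^ 2) by ring,
      hX, hY, g1, g2, hP]
    ring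
  obtain ⟨L, hL⟩ : ∃ L, L = 4 * y ^ 2 + 8 * p * n * y + 12 * n ^ 2 * y + 6 * n ^ 4 - 4 * A * n ^ 3
            + n ^ 2 * (A ^ 2 + 2 * B ^ 2 + (4 * p + A) ^ 2 + 4 * s - 2 * γ * j ^ 2
              + 2 * A * p + 2 * B * q)
            + 2 * n * (p * (2 * y + 2 * n ^ 2 - A * n) - q * (B * n)) := ⟨_, rfl⟩
  have eL : L = 2 * (a ^ 2 + b ^ 2) - (4 * n ^ 2 + 8 * y) * a + 6 * n ^ 4 + 20 * n ^ 2 * y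
      + 12 * y ^ 2 + 28 * p * n * y + 20 * p * n ^ 3 - 8 * p * n * a + 16 * p ^ 2 * n ^ 2
      + 4 * s * n ^ 2 - 2 * γ * j ^ 2 * n ^ 2 := by
    rw [hL, ha, hb]; ring
  have es : 4 * s * n ^ 2 = 2 * n * (e * (P * X + j * a) - k * (P * Y + j * b))
      + 2 * γ * j ^ 2 * n ^ 2 * (e ^ 2 - k ^ 2) := by
    rw [hX, hY, hv, hw]
    linear_combination (-4 * s * n ^ 2) * hu
  have key : n ^ 2 * ((T₁ ^ 2 + T₂ ^ 2) / 4 - (300 + 4 * γ) * j ^ 2 - (80 + 2 * μ) * n ^ 2)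
      - 300 * y ^ 2 ≤ P * (X ^ 2 + Y ^ 2) + (L - (a ^ 2 + b ^ 2)) := by
    have i1 : n ^ 2 * (T₁ ^ 2 + T₂ ^ 2) ≤ 2 * (a ^ 2 + b ^ 2) + 2 * P * (X ^ 2 + Y ^ 2) := by
      have : n ^ 2 * (T₁ ^ 2 + T₂ ^ 2) = (a + j * X) ^ 2 + (b + j * Y) ^ 2 := by
        rw [← t1, ← t2]; ring
      rw [this]
      linarith only [sq_nonneg (a - j * X), sq_nonneg (b - j * Y),
        mul_le_mul_of_nonneg_right hjP (add_nonneg (sq_nonneg X) (sq_nonneg Y))]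
    have i2 : -(P * (X ^ 2 + Y ^ 2) / 2) - 2 * P * n ^ 2 ≤ 2 * n * P * (e * X - k * Y) := by
      have := mul_nonneg hP0.le (add_nonneg (sq_nonneg (X + 2 * n * e)) (sq_nonneg (Y - 2 * n * k)))
      have h3 := congrArg (fun r => 2 * P * n ^ 2 * r) hu
      linarith only [this, h3]
    have i3 : -((a ^ 2 + b ^ 2) / 16) - 16 * n ^ 2 * j ^ 2 ≤ 2 * n * j * (e * a - k * b) := by
      have := congrArg (fun r => 16 * n ^ 2 * j ^ 2 * r) hu
      linarith only [this, sq_nonneg (a / 4 + 4 * n * j * e), sq_nonneg (b / 4 - 4 * n * j * k)]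
    have i4 : 4 * n ^ 2 * a ≤ a ^ 2 / 16 + 64 * n ^ 4 := by
      linarith only [sq_nonneg (a / 4 - 8 * n ^ 2)]
    have i5 : 8 * y * a ≤ a ^ 2 / 16 + 256 * y ^ 2 := by
      linarith only [sq_nonneg (a / 4 - 16 * y)]
    have i6 : 8 * p * n * a ≤ a ^ 2 / 16 + 256 * (p ^ 2 * n ^ 2) := by
      linarith only [sq_nonneg (a / 4 - 16 * p * n)]
    have i7 : -(16 * (p ^ 2 * n ^ 2)) - 49 / 4 * y ^ 2 ≤ 28 * p * n * y := by
      linarith only [sq_nonneg (4 * p * n + 7 / 2 * y)]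
    have i8 : -(10 * (p ^ 2 * n ^ 2)) - 10 * n ^ 4 ≤ 20 * p * n ^ 3 := by
      linarith only [sq_nonneg (p * n + n ^ 2)]
    have i9 : p ^ 2 * n ^ 2 ≤ j ^ 2 * n ^ 2 := by
      rw [hj]; linarith only [mul_nonneg (sq_nonneg q) (sq_nonneg n)]
    have i10 : 0 ≤ n ^ 2 * y := by positivity
    have i11 : -(4 * (γ * j ^ 2 * n ^ 2)) ≤
        2 * γ * j ^ 2 * n ^ 2 * (e ^ 2 - k ^ 2) - 2 * γ * j ^ 2 * n ^ 2 := by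
      have : 0 ≤ γ * j ^ 2 * n ^ 2 * e ^ 2 := by positivity
      have h3 := congrArg (fun r => γ * j ^ 2 * n ^ 2 * r) hu
      linarith only [this, h3]
    have i12 : P * n ^ 2 = j ^ 2 * n ^ 2 + μ * n ^ 4 := by rw [hP]; ring
    have i13 : 0 ≤ n ^ 4 := by positivity
    have i14 : 0 ≤ y ^ 2 := sq_nonneg y
    have i15 : 0 ≤ j ^ 2 * n ^ 2 := by positivity
    have i16 : 0 ≤ a ^ 2 := sq_nonneg a
    have i17 : 0 ≤ b ^ 2 := sq_nonneg b
    rw [eL, es]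
    linarith only [i1, i2, i3, i4, i5, i6, i7, i8, i9, i10, i11, i12, i13, i14, i15, i16, i17]
  have key' := mul_le_mul_of_nonneg_left key (mul_nonneg hP0.le hμ.le)
  have hrest : 0 ≤ P * (2 * γ ^ 2 * (j ^ 2) ^ 2 + ((A + 3 * p) ^ 2 + (B + q) ^ 2 - j ^ 2) * j ^ 2) := by
    apply mul_nonneg hP0.le
    have : 0 ≤ (γ ^ 2 - 1) * (j ^ 2) ^ 2 := by
      exact mul_nonneg (by nlinarith only [hγ]) (by positivity)
    nlinarith only [this, mul_nonneg (sq_nonneg (A + 3 * p)) (sq_nonneg j),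
      mul_nonneg (sq_nonneg (B + q)) (sq_nonneg j), sq_nonneg (γ * j ^ 2)]
  rw [eΦ, ← hL]
  linarith only [key', hrest, eT]

end Inequality

section Estimate

/-- Absorption of the lower-order terms, given the parameters `α`, `k`, `μ = k² / (16 α)`. -/
lemma sq_le_of_absorption {n ν₁ ν₂ Φ α β k μ P : ℝ} (hβ : 0 < β) (hα : 16 + 608 / β ≤ α)
    (hk : 8 * α ≤ k) (hμ : μ = k ^ 2 / (16 * α)) (hΦ : 0 ≤ Φ) (hP : P = Φ + μ * n ^ 2) :
    P ^ 2 ≤ μ * n ^ 2 * (((k * n + α * ν₁) ^ 2 + (α * ν₂) ^ 2) / 4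
        - (300 + 4 * (1 + β)) * Φ - (80 + 2 * μ) * n ^ 2)
      + P * (α * (ν₁ ^ 2 + ν₂ ^ 2) - 2 * k * ν₁ * n - k * n ^ 2 + α * β * Φ) := by
  have hα16 : 16 ≤ α := le_trans (by have : 0 ≤ 608 / β := by positivity
                                     linarith) hα
  have hα0 : 0 < α := by linarith
  have hk0 : 0 < k := by linarith
  have hαβ : 16 * β + 608 ≤ α * β := by
    have := mul_le_mul_of_nonneg_right hα hβ.le
    rwa [add_mul, div_mul_cancel₀ _ hβ.ne'] at this
  have hμα : 16 * α * μ = k ^ 2 := by rw [hμ]; field_simp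
  have hμ0 : 0 < μ := by rw [hμ]; positivity
  have hkμ : k ≤ 2 * μ := by
    have : α * k ≤ α * (2 * μ) := by nlinarith only [hμα, hk, hk0]
    exact le_of_mul_le_mul_left this hα0
  have h80 : 80 ≤ 2 * μ := by linarith
  obtain ⟨N, hN⟩ : ∃ N, N = n ^ 2 := ⟨_, rfl⟩
  have hN0 : 0 ≤ N := hN ▸ sq_nonneg n
  have hm0 : 0 ≤ μ * N := by positivity
  have hP0 : 0 ≤ P := by rw [hP, ← hN]; positivity
  have hmP : μ * N ≤ P := by rw [hP, ← hN]; linarith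
  have hkN : k * N ≤ 2 * (μ * N) := by
    have := mul_le_mul_of_nonneg_right hkμ hN0
    linarith
  have h80N : (80 + 2 * μ) * N ≤ 4 * (μ * N) := by
    have := mul_le_mul_of_nonneg_right h80 hN0
    linarith
  have low : μ * N * ((300 + 4 * (1 + β)) * Φ + (80 + 2 * μ) * N) ≤
      P * ((300 + 4 * (1 + β)) * Φ + 4 * (μ * N)) := by
    apply mul_le_mul hmP _ (by positivity) hP0
    linarith
  have bΦ : 0 ≤ (α * β - 4 * (1 + β) - 324) * Φ := mul_nonneg (by linarith) hΦ
  rw [← hN]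
  rw [← hN] at hP
  rcases le_total Φ (μ * N) with hc | hc
  · have h1 : P * (((k * n + α * ν₁) ^ 2 + (α * ν₂) ^ 2) / 8) ≤
        μ * N * (((k * n + α * ν₁) ^ 2 + (α * ν₂) ^ 2) / 4) := by
      have : P ≤ 2 * (μ * N) := by linarith
      have := mul_le_mul_of_nonneg_right this
        (show 0 ≤ ((k * n + α * ν₁) ^ 2 + (α * ν₂) ^ 2) / 8 by positivity)
      linarith
    have h2 : 16 * (μ * N) ≤ ((k * n + α * ν₁) ^ 2 + (α * ν₂) ^ 2) / 8
        + α * (ν₁ ^ 2 + ν₂ ^ 2) - 2 * k * ν₁ * n := by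
      have e : α * (((k * n + α * ν₁) ^ 2 + (α * ν₂) ^ 2) / 8
          + α * (ν₁ ^ 2 + ν₂ ^ 2) - 2 * k * ν₁ * n - 16 * (μ * N)) =
          (α / 8 - 1) * (k * n + α * ν₁) ^ 2 + 2 * (α * ν₁) ^ 2
            + (α / 8 + 1) * (α * ν₂) ^ 2 := by
        rw [hN]; linear_combination (-n ^ 2) * hμα
      have : 0 ≤ α * (((k * n + α * ν₁) ^ 2 + (α * ν₂) ^ 2) / 8
          + α * (ν₁ ^ 2 + ν₂ ^ 2) - 2 * k * ν₁ * n - 16 * (μ * N)) := by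
        rw [e]
        have : 0 ≤ α / 8 - 1 := by linarith
        positivity
      have := nonneg_of_mul_nonneg_right this hα0
      linarith
    have h3 : P * P ≤ P * (16 * (μ * N) - k * N + α * β * Φ
        - (300 + 4 * (1 + β)) * Φ - 4 * (μ * N)) := by
      apply mul_le_mul_of_nonneg_left _ hP0
      rw [hP]; linarith
    have h4 := mul_le_mul_of_nonneg_left h2 hP0
    linarith only [h1, h3, h4, low]
  · have h2 : -(16 * (μ * N)) ≤ α * (ν₁ ^ 2 + ν₂ ^ 2) - 2 * k * ν₁ * n := by
      have e : α * (α * (ν₁ ^ 2 + ν₂ ^ 2) - 2 * k * ν₁ * n + 16 * (μ * N)) =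
          (α * ν₁ - k * n) ^ 2 + (α * ν₂) ^ 2 := by
        rw [hN]; linear_combination (n ^ 2) * hμα
      have : 0 ≤ α * (α * (ν₁ ^ 2 + ν₂ ^ 2) - 2 * k * ν₁ * n + 16 * (μ * N)) := by
        rw [e]; positivity
      have := nonneg_of_mul_nonneg_right this hα0
      linarith
    have h3 : P * P ≤ P * (-(16 * (μ * N)) - k * N + α * β * Φ
        - (300 + 4 * (1 + β)) * Φ - 4 * (μ * N)) := by
      apply mul_le_mul_of_nonneg_left _ hP0
      rw [hP]; linarith
    have h4 := mul_le_mul_of_nonneg_left h2 hP0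
    have h5 : 0 ≤ μ * N * (((k * n + α * ν₁) ^ 2 + (α * ν₂) ^ 2) / 4) := by positivity
    linarith only [h5, h3, h4, low]

/-- The upper bound for `P = Φ + μ n²` at a maximum point of the test function. -/
lemma le_of_second_order_condition {n y h p q A B s t α β k μ P ν₁ ν₂ c₁ c₂ : ℝ}
    (hβ : 0 < β) (hα : 16 + 608 / β ≤ α) (hk : 8 * α ≤ k) (hμ : μ = k ^ 2 / (16 * α))
    (hP : P = p ^ 2 + q ^ 2 + μ * n ^ 2) (hP0 : 0 < P) (hy : 0 < y)
    (hc₁ : 0 ≤ c₁) (hc₂ : 0 ≤ c₂)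
    (h1 : 2 * (s * p + t * q) - (1 + β) * (p ^ 2 + q ^ 2) * p
      + μ * (n * (2 * y + 2 * n ^ 2 - A * n)) = P * (k * n + α * ν₁))
    (h2 : 2 * (t * p - s * q) - (1 + β) * (p ^ 2 + q ^ 2) * q + μ * (n * (-(B * n)))
      = P * (α * ν₂))
    (hν : |n * p - n * ν₁| ≤ c₁ * y) (hh : 1 / h ≤ c₂ * y)
    (h3 : 4 * (s ^ 2 + t ^ 2) - 4 * (1 + β) * (s * (p ^ 2 - q ^ 2) + 2 * t * p * q)
          + 3 * (1 + β) ^ 2 * (p ^ 2 + q ^ 2) ^ 2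
          + ((A + 3 * p) ^ 2 + (B + q) ^ 2 - (p ^ 2 + q ^ 2)) * (p ^ 2 + q ^ 2)
          + μ * (4 * y ^ 2 + 8 * p * n * y + 12 * n ^ 2 * y + 6 * n ^ 4 - 4 * A * n ^ 3
            + n ^ 2 * (A ^ 2 + 2 * B ^ 2 + (4 * p + A) ^ 2 + 4 * s
              - 2 * (1 + β) * (p ^ 2 + q ^ 2) + 2 * A * p + 2 * B * q)
            + 2 * n * (p * (2 * y + 2 * n ^ 2 - A * n) - q * (B * n)))
        - P * ((k * n + α * ν₁) ^ 2 + (α * ν₂) ^ 2)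
        + P * (-2 * k * p * n - k * n ^ 2 - 2 * k * y + α * (ν₁ ^ 2 + ν₂ ^ 2)
          + α * β * (p ^ 2 + q ^ 2) - 2 * α * (1 / h)) ≤ 0) :
    P ≤ (2 * k * c₁ + 2 * k + 2 * α * c₂ + 300 * μ + 1) * y := by
  have hα0 : 0 < α := lt_of_lt_of_le (by positivity) hα
  have hk0 : 0 < k := by linarith
  have hμ0 : 0 < μ := by rw [hμ]; positivity
  have b := bochner_lower_bound (γ := 1 + β) (by linarith) hμ0 hP hP0 hy.le h1 h2
  have a := sq_le_of_absorption (n := n) (ν₁ := ν₁) (ν₂ := ν₂) hβ hα hk hμ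
    (show 0 ≤ p ^ 2 + q ^ 2 by positivity) hP
  set E := 4 * (s ^ 2 + t ^ 2) - 4 * (1 + β) * (s * (p ^ 2 - q ^ 2) + 2 * t * p * q)
          + 3 * (1 + β) ^ 2 * (p ^ 2 + q ^ 2) ^ 2
          + ((A + 3 * p) ^ 2 + (B + q) ^ 2 - (p ^ 2 + q ^ 2)) * (p ^ 2 + q ^ 2)
          + μ * (4 * y ^ 2 + 8 * p * n * y + 12 * n ^ 2 * y + 6 * n ^ 4 - 4 * A * n ^ 3
            + n ^ 2 * (A ^ 2 + 2 * B ^ 2 + (4 * p + A) ^ 2 + 4 * s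
              - 2 * (1 + β) * (p ^ 2 + q ^ 2) + 2 * A * p + 2 * B * q)
            + 2 * n * (p * (2 * y + 2 * n ^ 2 - A * n) - q * (B * n)))
  set W := μ * n ^ 2 * (((k * n + α * ν₁) ^ 2 + (α * ν₂) ^ 2) / 4
        - (300 + 4 * (1 + β)) * (p ^ 2 + q ^ 2) - (80 + 2 * μ) * n ^ 2)
  have b' : W - 300 * μ * y ^ 2 ≤ E - P * ((k * n + α * ν₁) ^ 2 + (α * ν₂) ^ 2) := by
    apply le_of_mul_le_mul_left _ hP0
    linarith only [b]
  have g1 : P * (2 * k * (n * p - n * ν₁)) ≤ P * (2 * k * (c₁ * y)) := by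
    apply mul_le_mul_of_nonneg_left _ hP0.le
    exact mul_le_mul_of_nonneg_left (le_trans (le_abs_self _) hν) (by positivity)
  have g2 : P * (2 * α * (1 / h)) ≤ P * (2 * α * (c₂ * y)) := by
    apply mul_le_mul_of_nonneg_left _ hP0.le
    exact mul_le_mul_of_nonneg_left hh (by positivity)
  have main : P ^ 2 ≤ (2 * k * c₁ + 2 * k + 2 * α * c₂) * y * P + 300 * μ * y ^ 2 := by
    linarith only [a, b', h3, g1, g2]
  by_contra! hlt
  set c := 2 * k * c₁ + 2 * k + 2 * α * c₂
  have hc : 0 ≤ c := by positivity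
  have f1 : (c + 300 * μ + 1) * y * P ≤ P * P := mul_le_mul_of_nonneg_right hlt.le hP0.le
  have f2 : y ≤ P := by
    have : 0 ≤ (c + 300 * μ) * y := by positivity
    linarith
  have f3 : (300 * μ + 1) * y * y ≤ (300 * μ + 1) * y * P :=
    mul_le_mul_of_nonneg_left f2 (by positivity)
  have f4 : 0 < y * y := by positivity
  linarith only [main, f1, f3, f4]

end Estimate

section Jets

/-- `φ` is smooth on the open neighbourhood `U` of `x`, and its value and its first two
derivatives along `v` at `x` are `p₀`, `p₁`, `p₂`. -/
structure HasJet (U : Set (Fin 2 → ℝ)) (v x : Fin 2 → ℝ) (φ : (Fin 2 → ℝ) → ℝ)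
    (p₀ p₁ p₂ : ℝ) : Prop where
  isOpen : IsOpen U
  mem : x ∈ U
  smooth : ContDiffOn ℝ (⊤ : ℕ∞) φ U
  val : φ x = p₀
  fst : dird v φ x = p₁
  snd : dird v (dird v φ) x = p₂

namespace HasJet

variable {U : Set (Fin 2 → ℝ)} {φ ψ : (Fin 2 → ℝ) → ℝ} {v x : Fin 2 → ℝ}
  {p₀ p₁ p₂ q₀ q₁ q₂ : ℝ}

lemma differentiableAt (h : HasJet U v x φ p₀ p₁ p₂) : DifferentiableAt ℝ φ x :=
  differentiableAt_of_smoothOn h.isOpen h.smooth h.mem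

lemma of_smooth (hU : IsOpen U) (hx : x ∈ U) (hφ : ContDiffOn ℝ (⊤ : ℕ∞) φ U) (v : Fin 2 → ℝ) :
    HasJet U v x φ (φ x) (dird v φ x) (dird v (dird v φ) x) :=
  ⟨hU, hx, hφ, rfl, rfl, rfl⟩

lemma const (hU : IsOpen U) (hx : x ∈ U) (v : Fin 2 → ℝ) (c : ℝ) :
    HasJet U v x (fun _ => c) c 0 0 := by
  have h : ∀ c : ℝ, dird v (fun _ => c) = fun _ => 0 := fun c => funext fun y => dird_const c v
  exact ⟨hU, hx, contDiffOn_const, rfl, by rw [h], by rw [h, h]⟩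

lemma add (hφ : HasJet U v x φ p₀ p₁ p₂) (hψ : HasJet U v x ψ q₀ q₁ q₂) :
    HasJet U v x (fun y => φ y + ψ y) (p₀ + q₀) (p₁ + q₁) (p₂ + q₂) :=
  ⟨hφ.isOpen, hφ.mem, hφ.smooth.add hψ.smooth, by rw [hφ.val, hψ.val],
    by rw [dird_add hφ.differentiableAt hψ.differentiableAt, hφ.fst, hψ.fst],
    by rw [dird_dird_add hφ.isOpen hφ.smooth hψ.smooth v v hφ.mem, hφ.snd, hψ.snd]⟩

lemma sub (hφ : HasJet U v x φ p₀ p₁ p₂) (hψ : HasJet U v x ψ q₀ q₁ q₂) :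
    HasJet U v x (fun y => φ y - ψ y) (p₀ - q₀) (p₁ - q₁) (p₂ - q₂) :=
  ⟨hφ.isOpen, hφ.mem, hφ.smooth.sub hψ.smooth, by rw [hφ.val, hψ.val],
    by rw [dird_sub hφ.differentiableAt hψ.differentiableAt, hφ.fst, hψ.fst],
    by rw [dird_dird_sub hφ.isOpen hφ.smooth hψ.smooth v v hφ.mem, hφ.snd, hψ.snd]⟩

lemma mul (hφ : HasJet U v x φ p₀ p₁ p₂) (hψ : HasJet U v x ψ q₀ q₁ q₂) :
    HasJet U v x (fun y => φ y * ψ y) (p₀ * q₀) (p₁ * q₀ + p₀ * q₁)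
      (p₂ * q₀ + 2 * (p₁ * q₁) + p₀ * q₂) :=
  ⟨hφ.isOpen, hφ.mem, hφ.smooth.mul hψ.smooth, by rw [hφ.val, hψ.val],
    by rw [dird_mul hφ.differentiableAt hψ.differentiableAt, hφ.val, hψ.val, hφ.fst, hψ.fst],
    by
      rw [dird_dird_mul hφ.isOpen hφ.smooth hψ.smooth v v hφ.mem, hφ.val, hψ.val, hφ.fst, hψ.fst,
        hφ.snd, hψ.snd]
      ring⟩

lemma const_mul (hφ : HasJet U v x φ p₀ p₁ p₂) (c : ℝ) :
    HasJet U v x (fun y => c * φ y) (c * p₀) (c * p₁) (c * p₂) := by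
  have := (const hφ.isOpen hφ.mem v c).mul hφ
  simpa using this

lemma congr (hφ : HasJet U v x φ p₀ p₁ p₂) (h : ∀ y ∈ U, ψ y = φ y) :
    HasJet U v x ψ p₀ p₁ p₂ :=
  ⟨hφ.isOpen, hφ.mem, hφ.smooth.congr h, by rw [h x hφ.mem, hφ.val],
    by rw [dird_congr hφ.isOpen h v hφ.mem, hφ.fst],
    by rw [dird_congr hφ.isOpen (fun y hy => dird_congr hφ.isOpen h v hy) v hφ.mem, hφ.snd]⟩

lemma unique (hφ : HasJet U v x φ p₀ p₁ p₂) (hφ' : HasJet U v x φ q₀ q₁ q₂) :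
    p₀ = q₀ ∧ p₁ = q₁ ∧ p₂ = q₂ :=
  ⟨hφ.val.symm.trans hφ'.val, hφ.fst.symm.trans hφ'.fst, hφ.snd.symm.trans hφ'.snd⟩

lemma inv (hφ : HasJet U v x φ p₀ p₁ p₂) (h0 : ∀ y ∈ U, φ y ≠ 0) :
    HasJet U v x (fun y => (φ y)⁻¹) p₀⁻¹ (-p₁ * p₀⁻¹ ^ 2) (2 * p₁ ^ 2 * p₀⁻¹ ^ 3 - p₂ * p₀⁻¹ ^ 2) := by
  have hs : ContDiffOn ℝ (⊤ : ℕ∞) (fun y => (φ y)⁻¹) U := hφ.smooth.inv h0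
  have hp : p₀ ≠ 0 := hφ.val ▸ h0 x hφ.mem
  have hv : (φ x)⁻¹ = p₀⁻¹ := by rw [hφ.val]
  have h1 := hφ.mul (of_smooth hφ.isOpen hφ.mem hs v)
  obtain ⟨-, e1, e2⟩ := h1.unique
    ((const hφ.isOpen hφ.mem v 1).congr fun y hy => mul_inv_cancel₀ (h0 y hy))
  rw [hv] at e1 e2
  have f1 : dird v (fun y => (φ y)⁻¹) x = -p₁ * p₀⁻¹ ^ 2 := by
    field_simp at e1 ⊢
    linarith
  refine ⟨hφ.isOpen, hφ.mem, hs, hv, f1, ?_⟩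
  rw [f1] at e2
  field_simp at e2 ⊢
  linarith

lemma log (hφ : HasJet U v x φ p₀ p₁ p₂) (h0 : ∀ y ∈ U, φ y ≠ 0) :
    HasJet U v x (fun y => Real.log (φ y)) (Real.log p₀) (p₁ / p₀) (p₂ / p₀ - (p₁ / p₀) ^ 2) := by
  have hp : p₀ ≠ 0 := hφ.val ▸ h0 x hφ.mem
  have e1 := dird_log hφ.differentiableAt (h0 x hφ.mem) v
  have e2 := dird_dird_log hφ.isOpen hφ.smooth h0 v v hφ.mem
  rw [hφ.val, hφ.fst] at e1
  have f1 : dird v (fun y => Real.log (φ y)) x = p₁ / p₀ := by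
    field_simp; linarith
  refine ⟨hφ.isOpen, hφ.mem, hφ.smooth.log h0, by rw [hφ.val], f1, ?_⟩
  rw [hφ.val, hφ.snd, f1] at e2
  field_simp at e2 ⊢
  linarith

/-- The jet of `N = (c h₁² - 2 b h₁ h₂ + a h₂²) / (a c - b²)` at a point where `a = c = 1`
and `b = 0`. -/
lemma quadratic {N a b c h₁ h₂ : (Fin 2 → ℝ) → ℝ}
    {N₀ N₁ N₂ a₁ a₂ b₁ b₂ c₁ c₂ r₀ r₁ r₂ s₀ s₁ s₂ : ℝ}
    (hN : HasJet U v x N N₀ N₁ N₂) (ha : HasJet U v x a 1 a₁ a₂) (hb : HasJet U v x b 0 b₁ b₂)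
    (hc : HasJet U v x c 1 c₁ c₂) (h1 : HasJet U v x h₁ r₀ r₁ r₂)
    (h2 : HasJet U v x h₂ s₀ s₁ s₂)
    (h : ∀ y ∈ U, N y * (a y * c y - b y * b y) =
      c y * (h₁ y * h₁ y) - 2 * (b y * (h₁ y * h₂ y)) + a y * (h₂ y * h₂ y)) :
    N₀ = r₀ ^ 2 + s₀ ^ 2 ∧
    N₁ = 2 * (r₀ * r₁ + s₀ * s₁) - (a₁ * r₀ ^ 2 + 2 * b₁ * r₀ * s₀ + c₁ * s₀ ^ 2) ∧
    N₂ = 2 * (r₁ ^ 2 + s₁ ^ 2) + 2 * (r₀ * r₂ + s₀ * s₂)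
      - 4 * (a₁ * r₀ * r₁ + b₁ * (r₀ * s₁ + s₀ * r₁) + c₁ * s₀ * s₁)
      - (a₂ * r₀ ^ 2 + 2 * b₂ * r₀ * s₀ + c₂ * s₀ ^ 2)
      + 2 * ((a₁ * r₀ + b₁ * s₀) ^ 2 + (b₁ * r₀ + c₁ * s₀) ^ 2) := by
  have jr := ((hc.mul (h1.mul h1)).sub ((hb.mul (h1.mul h2)).const_mul 2)).add (ha.mul (h2.mul h2))
  obtain ⟨e0, e1, e2⟩ := (hN.mul ((ha.mul hc).sub (hb.mul hb))).unique (jr.congr h)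
  have f0 : N₀ = r₀ ^ 2 + s₀ ^ 2 := by linear_combination e0
  have f1 : N₁ = 2 * (r₀ * r₁ + s₀ * s₁) - (a₁ * r₀ ^ 2 + 2 * b₁ * r₀ * s₀ + c₁ * s₀ ^ 2) := by
    rw [f0] at e1
    linear_combination e1
  refine ⟨f0, f1, ?_⟩
  rw [f0, f1] at e2
  linear_combination e2

end HasJet

end Jets

section FrameAlgebra

/-- The components of `∇Φ` and the drift Laplacian of `Φ` in an orthonormal frame. Here
`σ₁, σ₂` is the gradient of `log ρ`, `S₁₁, …` and `u₁₁₁, …` are its second and third derivatives,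
`A, B, G, H` and `f₁₁₁₁, …` the third and fourth derivatives of `f`. -/
lemma frame_Phi {σ₁ σ₂ A B G H f₁₁₁₁ f₁₁₁₂ f₁₁₂₂ f₁₂₂₂ f₂₂₂₂ S₁₁ S₁₂ S₂₂ u₁₁₁ u₁₁₂ u₁₂₂ u₂₂₂ β s t
      Φ Φ₁ Φ₂ Φ₁₁ Φ₂₂ : ℝ}
    (hG : A + G = -4 * σ₁) (hH : B + H = -4 * σ₂)
    (h11 : f₁₁₁₁ + f₁₁₂₂ + 2 * (A * G) - 2 * B ^ 2 = -4 * S₁₁ + 16 * σ₁ ^ 2)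
    (h22 : f₁₁₂₂ + f₂₂₂₂ + 2 * (B * H) - 2 * G ^ 2 = -4 * S₂₂ + 16 * σ₂ ^ 2)
    (h12 : f₁₁₁₂ + f₁₂₂₂ + A * H - B * G = -4 * S₁₂ + 16 * (σ₁ * σ₂))
    (hS : S₁₁ + S₂₂ = -(3 + β) * (σ₁ ^ 2 + σ₂ ^ 2))
    (hu1 : G * S₁₁ - 2 * (B * S₁₂) + A * S₂₂ + u₁₁₁ + u₁₂₂ =
      -(3 + β) * (G * σ₁ ^ 2 - 2 * (B * σ₁ * σ₂) + A * σ₂ ^ 2 + 2 * (σ₁ * S₁₁ + σ₂ * S₁₂)))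
    (hu2 : H * S₁₁ - 2 * (G * S₁₂) + B * S₂₂ + u₁₁₂ + u₂₂₂ =
      -(3 + β) * (H * σ₁ ^ 2 - 2 * (G * σ₁ * σ₂) + B * σ₂ ^ 2 + 2 * (σ₁ * S₁₂ + σ₂ * S₂₂)))
    (hs : s = S₁₁ - (A * σ₁ + B * σ₂) / 2 + (1 + β) * (σ₁ ^ 2 + σ₂ ^ 2) / 2)
    (ht : t = S₁₂ - (B * σ₁ + G * σ₂) / 2)
    (hΦ : Φ = σ₁ ^ 2 + σ₂ ^ 2)
    (hΦ₁ : Φ₁ = 2 * (σ₁ * S₁₁ + σ₂ * S₁₂) - (A * σ₁ ^ 2 + 2 * B * σ₁ * σ₂ + G * σ₂ ^ 2))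
    (hΦ₂ : Φ₂ = 2 * (σ₁ * S₁₂ + σ₂ * S₂₂) - (B * σ₁ ^ 2 + 2 * G * σ₁ * σ₂ + H * σ₂ ^ 2))
    (hΦ₁₁ : Φ₁₁ = 2 * (S₁₁ ^ 2 + S₁₂ ^ 2) + 2 * (σ₁ * u₁₁₁ + σ₂ * u₁₁₂)
      - 4 * (A * σ₁ * S₁₁ + B * (σ₁ * S₁₂ + σ₂ * S₁₁) + G * σ₂ * S₁₂)
      - (f₁₁₁₁ * σ₁ ^ 2 + 2 * f₁₁₁₂ * σ₁ * σ₂ + f₁₁₂₂ * σ₂ ^ 2)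
      + 2 * ((A * σ₁ + B * σ₂) ^ 2 + (B * σ₁ + G * σ₂) ^ 2))
    (hΦ₂₂ : Φ₂₂ = 2 * (S₁₂ ^ 2 + S₂₂ ^ 2) + 2 * (σ₁ * u₁₂₂ + σ₂ * u₂₂₂)
      - 4 * (B * σ₁ * S₁₂ + G * (σ₁ * S₂₂ + σ₂ * S₁₂) + H * σ₂ * S₂₂)
      - (f₁₁₂₂ * σ₁ ^ 2 + 2 * f₁₂₂₂ * σ₁ * σ₂ + f₂₂₂₂ * σ₂ ^ 2)
      + 2 * ((B * σ₁ + G * σ₂) ^ 2 + (G * σ₁ + H * σ₂) ^ 2)) :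
    Φ₁ = 2 * (s * σ₁ + t * σ₂) - (1 + β) * Φ * σ₁ ∧
    Φ₂ = 2 * (t * σ₁ - s * σ₂) - (1 + β) * Φ * σ₂ ∧
    Φ₁₁ + Φ₂₂ + 2 * (σ₁ * Φ₁ + σ₂ * Φ₂) =
      4 * (s ^ 2 + t ^ 2) - 4 * (1 + β) * (s * (σ₁ ^ 2 - σ₂ ^ 2) + 2 * t * σ₁ * σ₂)
        + 3 * (1 + β) ^ 2 * Φ ^ 2 + ((A + 3 * σ₁) ^ 2 + (B + σ₂) ^ 2 - Φ) * Φ := by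
  obtain rfl : G = -4 * σ₁ - A := by linarith
  obtain rfl : H = -4 * σ₂ - B := by linarith
  obtain rfl : S₂₂ = -(3 + β) * (σ₁ ^ 2 + σ₂ ^ 2) - S₁₁ := by linarith
  subst hΦ hΦ₁ hΦ₂ hΦ₁₁ hΦ₂₂ hs ht
  refine ⟨by ring, by ring, ?_⟩
  linear_combination 2 * σ₁ * hu1 + 2 * σ₂ * hu2 - σ₁ ^ 2 * h11 - σ₂ ^ 2 * h22
    - 2 * σ₁ * σ₂ * h12

/-- The components of `∇ℓ` and the drift Laplacian of `ℓ = Q / z²`, with `Q = ‖∇f‖²`, `y = 1 / z`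
and `z = C - f`, in an orthonormal frame whose first vector is parallel to `∇f`. -/
lemma frame_gradient {σ₁ σ₂ A B G f₁₁₁₁ f₁₁₂₂ S₁₁ β s q y Φ Q Q₁ Q₂ Q₁₁ Q₂₂
      ℓ₁ ℓ₂ ℓ₁₁ ℓ₂₂ n : ℝ}
    (hG : A + G = -4 * σ₁)
    (h11 : f₁₁₁₁ + f₁₁₂₂ + 2 * (A * G) - 2 * B ^ 2 = -4 * S₁₁ + 16 * σ₁ ^ 2)
    (hs : s = S₁₁ - (A * σ₁ + B * σ₂) / 2 + (1 + β) * (σ₁ ^ 2 + σ₂ ^ 2) / 2)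
    (hΦ : Φ = σ₁ ^ 2 + σ₂ ^ 2)
    (hQ : Q = q ^ 2) (hQ₁ : Q₁ = 2 * q - A * q ^ 2) (hQ₂ : Q₂ = -(B * q ^ 2))
    (hQ₁₁ : Q₁₁ = 2 + 2 * (q * A) - 4 * (A * q) - f₁₁₁₁ * q ^ 2 + 2 * ((A * q) ^ 2 + (B * q) ^ 2))
    (hQ₂₂ : Q₂₂ = 2 + 2 * (q * G) - 4 * (G * q) - f₁₁₂₂ * q ^ 2 + 2 * ((B * q) ^ 2 + (G * q) ^ 2))
    (hn : n = q * y) (hℓ₁ : ℓ₁ = Q₁ * y ^ 2 + 2 * Q * q * y ^ 3)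
    (hℓ₂ : ℓ₂ = Q₂ * y ^ 2)
    (hℓ₁₁ : ℓ₁₁ = Q₁₁ * y ^ 2 + 4 * Q₁ * q * y ^ 3 + Q * (6 * q ^ 2 * y ^ 4 + 2 * y ^ 3))
    (hℓ₂₂ : ℓ₂₂ = Q₂₂ * y ^ 2 + 2 * Q * y ^ 3) :
    ℓ₁ = n * (2 * y + 2 * n ^ 2 - A * n) ∧ ℓ₂ = n * (-(B * n)) ∧
    ℓ₁₁ + ℓ₂₂ + 2 * (σ₁ * ℓ₁ + σ₂ * ℓ₂) =
      4 * y ^ 2 + 8 * σ₁ * n * y + 12 * n ^ 2 * y + 6 * n ^ 4 - 4 * A * n ^ 3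
        + n ^ 2 * (A ^ 2 + 2 * B ^ 2 + (4 * σ₁ + A) ^ 2 + 4 * s - 2 * (1 + β) * Φ
          + 2 * A * σ₁ + 2 * B * σ₂)
        + 2 * n * (σ₁ * (2 * y + 2 * n ^ 2 - A * n) - σ₂ * (B * n)) := by
  obtain rfl : G = -4 * σ₁ - A := by linarith
  subst hΦ hQ hQ₁ hQ₂ hQ₁₁ hQ₂₂ hs hn hℓ₁ hℓ₂ hℓ₁₁ hℓ₂₂
  refine ⟨by ring, by ring, ?_⟩
  linear_combination (-q ^ 2 * y ^ 2) * h11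

end FrameAlgebra

section FrameEstimate

/-- The maximum principle estimate in a frame `e₁, e₂` that is orthonormal for the Hessian of `f`
at `x`, with `e₂` tangent to the level set of `f`. Here `S = log ρ`, and `Φ`, `Q` are the squared
gradient norms of `S` and `f`. -/
lemma frame_estimate {U : Set (Fin 2 → ℝ)} {x e₁ e₂ : Fin 2 → ℝ}
    {f S Φ Q h ξ₁ ξ₂ : (Fin 2 → ℝ) → ℝ} {α β k μ d c₁ c₂ C' X₁ X₂ : ℝ}
    (hU : IsOpen U) (hx : x ∈ U)
    (hf : ContDiffOn ℝ (⊤ : ℕ∞) f U) (hS : ContDiffOn ℝ (⊤ : ℕ∞) S U)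
    (hΦ : ContDiffOn ℝ (⊤ : ℕ∞) Φ U) (hQ : ContDiffOn ℝ (⊤ : ℕ∞) Q U)
    (I₁ : ∀ y ∈ U, Φ y * (dird e₁ (dird e₁ f) y * dird e₂ (dird e₂ f) y
        - dird e₁ (dird e₂ f) y * dird e₁ (dird e₂ f) y) =
      dird e₂ (dird e₂ f) y * (dird e₁ S y * dird e₁ S y)
        - 2 * (dird e₁ (dird e₂ f) y * (dird e₁ S y * dird e₂ S y))
        + dird e₁ (dird e₁ f) y * (dird e₂ S y * dird e₂ S y))
    (I₂ : ∀ y ∈ U, Q y * (dird e₁ (dird e₁ f) y * dird e₂ (dird e₂ f) y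
        - dird e₁ (dird e₂ f) y * dird e₁ (dird e₂ f) y) =
      dird e₂ (dird e₂ f) y * (dird e₁ f y * dird e₁ f y)
        - 2 * (dird e₁ (dird e₂ f) y * (dird e₁ f y * dird e₂ f y))
        + dird e₁ (dird e₁ f) y * (dird e₂ f y * dird e₂ f y))
    (I₃ : ∀ v, ∀ y ∈ U, dird v (fun y => dird e₁ (dird e₁ f) y * dird e₂ (dird e₂ f) y
        - dird e₁ (dird e₂ f) y * dird e₁ (dird e₂ f) y) y =
      -4 * ((dird e₁ (dird e₁ f) y * dird e₂ (dird e₂ f) y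
        - dird e₁ (dird e₂ f) y * dird e₁ (dird e₂ f) y) * dird v S y))
    (I₄ : ∀ y ∈ U, dird e₂ (dird e₂ f) y * dird e₁ (dird e₁ S) y
        - 2 * (dird e₁ (dird e₂ f) y * dird e₁ (dird e₂ S) y)
        + dird e₁ (dird e₁ f) y * dird e₂ (dird e₂ S) y =
      -(3 + β) * (dird e₂ (dird e₂ f) y * (dird e₁ S y * dird e₁ S y)
        - 2 * (dird e₁ (dird e₂ f) y * (dird e₁ S y * dird e₂ S y))
        + dird e₁ (dird e₁ f) y * (dird e₂ S y * dird e₂ S y)))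
    (hh : ∀ y ∈ U, h y = d + (ξ₁ y * dird e₁ f y + ξ₂ y * dird e₂ f y) - f y)
    (ha : dird e₁ (dird e₁ f) x = 1) (hb : dird e₁ (dird e₂ f) x = 0)
    (hc : dird e₂ (dird e₂ f) x = 1) (hF₂ : dird e₂ f x = 0)
    (jξ₁₁ : HasJet U e₁ x ξ₁ X₁ 1 0) (jξ₁₂ : HasJet U e₁ x ξ₂ X₂ 0 0)
    (jξ₂₁ : HasJet U e₂ x ξ₁ X₁ 0 0) (jξ₂₂ : HasJet U e₂ x ξ₂ X₂ 1 0)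
    (hz : ∀ y ∈ U, 0 < C' - f y) (hh0 : ∀ y ∈ U, 0 < h y)
    (hP0 : ∀ y ∈ U, 0 < Φ y + μ * (Q y * ((C' - f y)⁻¹ * (C' - f y)⁻¹)))
    (hmax : IsLocalMax (fun y =>
      Real.log (Φ y + μ * (Q y * ((C' - f y)⁻¹ * (C' - f y)⁻¹))) + k * Real.log (C' - f y)
        - α * (S y + Real.log (h y))) x)
    (hβ : 0 < β) (hα : 16 + 608 / β ≤ α) (hk : 8 * α ≤ k) (hμ : μ = k ^ 2 / (16 * α))
    (hc₁ : 0 ≤ c₁) (hc₂ : 0 ≤ c₂)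
    (hfh : |h x - d + f x| ≤ c₁ * h x) (hhz : 1 / h x ≤ c₂ * (C' - f x)⁻¹) :
    Φ x + μ * (Q x * ((C' - f x)⁻¹ * (C' - f x)⁻¹)) ≤
      (2 * k * c₁ + 2 * k + 2 * α * c₂ + 300 * μ + 1) * (C' - f x)⁻¹ := by
  have sm : ∀ {φ : (Fin 2 → ℝ) → ℝ} (v : Fin 2 → ℝ), ContDiffOn ℝ (⊤ : ℕ∞) φ U →
      ContDiffOn ℝ (⊤ : ℕ∞) (dird v φ) U := fun v hφ => contDiffOn_dird hU hφ v
  have cm : ∀ {φ : (Fin 2 → ℝ) → ℝ}, ContDiffOn ℝ (⊤ : ℕ∞) φ U → ∀ y ∈ U,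
      dird e₂ (dird e₁ φ) y = dird e₁ (dird e₂ φ) y := fun hφ y hy => dird_comm hU hφ e₂ e₁ hy
  have cm₂ : ∀ {φ : (Fin 2 → ℝ) → ℝ}, ContDiffOn ℝ (⊤ : ℕ∞) φ U → ∀ y ∈ U,
      dird e₂ (dird e₁ (dird e₁ φ)) y = dird e₁ (dird e₁ (dird e₂ φ)) y := fun hφ y hy => by
    rw [cm (sm e₁ hφ) y hy, dird_congr hU (cm hφ) e₁ hy]
  have cm₃ : ∀ {φ : (Fin 2 → ℝ) → ℝ}, ContDiffOn ℝ (⊤ : ℕ∞) φ U → ∀ y ∈ U,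
      dird e₂ (dird e₂ (dird e₁ φ)) y = dird e₁ (dird e₂ (dird e₂ φ)) y := fun hφ y hy => by
    rw [dird_congr hU (cm hφ) e₂ hy, cm (sm e₂ hφ) y hy]
  have hF1 := sm e₁ hf
  have hF2 := sm e₂ hf
  have haS := sm e₁ hF1
  have hbS := sm e₁ hF2
  have hcS := sm e₂ hF2
  have hS1 := sm e₁ hS
  have hS2 := sm e₂ hS
  obtain ⟨q, hq⟩ : ∃ q, dird e₁ f x = q := ⟨_, rfl⟩
  obtain ⟨A, hA⟩ : ∃ A, dird e₁ (dird e₁ (dird e₁ f)) x = A := ⟨_, rfl⟩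
  obtain ⟨B, hB⟩ : ∃ B, dird e₁ (dird e₁ (dird e₂ f)) x = B := ⟨_, rfl⟩
  obtain ⟨G, hG⟩ : ∃ G, dird e₁ (dird e₂ (dird e₂ f)) x = G := ⟨_, rfl⟩
  obtain ⟨H, hH⟩ : ∃ H, dird e₂ (dird e₂ (dird e₂ f)) x = H := ⟨_, rfl⟩
  obtain ⟨m₁, hm₁⟩ : ∃ m, dird e₁ (dird e₁ (dird e₁ (dird e₁ f))) x = m := ⟨_, rfl⟩
  obtain ⟨m₂, hm₂⟩ : ∃ m, dird e₁ (dird e₁ (dird e₁ (dird e₂ f))) x = m := ⟨_, rfl⟩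
  obtain ⟨m₃, hm₃⟩ : ∃ m, dird e₁ (dird e₁ (dird e₂ (dird e₂ f))) x = m := ⟨_, rfl⟩
  obtain ⟨m₄, hm₄⟩ : ∃ m, dird e₂ (dird e₂ (dird e₁ (dird e₂ f))) x = m := ⟨_, rfl⟩
  obtain ⟨m₅, hm₅⟩ : ∃ m, dird e₂ (dird e₂ (dird e₂ (dird e₂ f))) x = m := ⟨_, rfl⟩
  obtain ⟨σ₁, hσ₁⟩ : ∃ m, dird e₁ S x = m := ⟨_, rfl⟩
  obtain ⟨σ₂, hσ₂⟩ : ∃ m, dird e₂ S x = m := ⟨_, rfl⟩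
  obtain ⟨S₁₁, hS₁₁⟩ : ∃ m, dird e₁ (dird e₁ S) x = m := ⟨_, rfl⟩
  obtain ⟨S₁₂, hS₁₂⟩ : ∃ m, dird e₁ (dird e₂ S) x = m := ⟨_, rfl⟩
  obtain ⟨S₂₂, hS₂₂⟩ : ∃ m, dird e₂ (dird e₂ S) x = m := ⟨_, rfl⟩
  obtain ⟨u₁, hu₁⟩ : ∃ m, dird e₁ (dird e₁ (dird e₁ S)) x = m := ⟨_, rfl⟩
  obtain ⟨u₂, hu₂⟩ : ∃ m, dird e₁ (dird e₁ (dird e₂ S)) x = m := ⟨_, rfl⟩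
  obtain ⟨u₃, hu₃⟩ : ∃ m, dird e₁ (dird e₂ (dird e₂ S)) x = m := ⟨_, rfl⟩
  obtain ⟨u₄, hu₄⟩ : ∃ m, dird e₂ (dird e₂ (dird e₂ S)) x = m := ⟨_, rfl⟩
  have jf1 : HasJet U e₁ x f (f x) q 1 := ⟨hU, hx, hf, rfl, hq, ha⟩
  have jf2 : HasJet U e₂ x f (f x) 0 1 := ⟨hU, hx, hf, rfl, hF₂, hc⟩
  have jF11 : HasJet U e₁ x (dird e₁ f) q 1 A := ⟨hU, hx, hF1, hq, ha, hA⟩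
  have jF21 : HasJet U e₁ x (dird e₂ f) 0 0 B := ⟨hU, hx, hF2, hF₂, hb, hB⟩
  have jF12 : HasJet U e₂ x (dird e₁ f) q 0 G :=
    ⟨hU, hx, hF1, hq, (cm hf x hx).trans hb, (cm₃ hf x hx).trans hG⟩
  have jF22 : HasJet U e₂ x (dird e₂ f) 0 1 H := ⟨hU, hx, hF2, hF₂, hc, hH⟩
  have ja1 : HasJet U e₁ x (dird e₁ (dird e₁ f)) 1 A m₁ := ⟨hU, hx, haS, ha, hA, hm₁⟩
  have jb1 : HasJet U e₁ x (dird e₁ (dird e₂ f)) 0 B m₂ := ⟨hU, hx, hbS, hb, hB, hm₂⟩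
  have jc1 : HasJet U e₁ x (dird e₂ (dird e₂ f)) 1 G m₃ := ⟨hU, hx, hcS, hc, hG, hm₃⟩
  have ja2 : HasJet U e₂ x (dird e₁ (dird e₁ f)) 1 B m₃ := by
    refine ⟨hU, hx, haS, ha, (cm₂ hf x hx).trans hB, ?_⟩
    rw [dird_congr hU (cm₂ hf) e₂ hx, cm₂ hF2 x hx, hm₃]
  have jb2 : HasJet U e₂ x (dird e₁ (dird e₂ f)) 0 G m₄ :=
    ⟨hU, hx, hbS, hb, (cm hF2 x hx).trans hG, hm₄⟩
  have jc2 : HasJet U e₂ x (dird e₂ (dird e₂ f)) 1 H m₅ := ⟨hU, hx, hcS, hc, hH, hm₅⟩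
  have jS1 : HasJet U e₁ x S (S x) σ₁ S₁₁ := ⟨hU, hx, hS, rfl, hσ₁, hS₁₁⟩
  have jS2 : HasJet U e₂ x S (S x) σ₂ S₂₂ := ⟨hU, hx, hS, rfl, hσ₂, hS₂₂⟩
  have js11 : HasJet U e₁ x (dird e₁ S) σ₁ S₁₁ u₁ := ⟨hU, hx, hS1, hσ₁, hS₁₁, hu₁⟩
  have js21 : HasJet U e₁ x (dird e₂ S) σ₂ S₁₂ u₂ := ⟨hU, hx, hS2, hσ₂, hS₁₂, hu₂⟩
  have js12 : HasJet U e₂ x (dird e₁ S) σ₁ S₁₂ u₃ :=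
    ⟨hU, hx, hS1, hσ₁, (cm hS x hx).trans hS₁₂, (cm₃ hS x hx).trans hu₃⟩
  have js22 : HasJet U e₂ x (dird e₂ S) σ₂ S₂₂ u₄ := ⟨hU, hx, hS2, hσ₂, hS₂₂, hu₄⟩
  have jΔ1 := (ja1.mul jc1).sub (jb1.mul jb1)
  have jΔ2 := (ja2.mul jc2).sub (jb2.mul jb2)
  have jR1 := ((jΔ1.mul js11).const_mul (-4)).congr (I₃ e₁)
  have jR2 := ((jΔ2.mul js22).const_mul (-4)).congr (I₃ e₂)
  have jR12 := ((jΔ1.mul js21).const_mul (-4)).congr (I₃ e₂)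
  have rG : A + G = -4 * σ₁ := by linear_combination jΔ1.fst.symm.trans jR1.val
  have rH : B + H = -4 * σ₂ := by linear_combination jΔ2.fst.symm.trans jR2.val
  have r11 : m₁ + m₃ + 2 * (A * G) - 2 * B ^ 2 = -4 * S₁₁ + 16 * σ₁ ^ 2 := by
    linear_combination jΔ1.snd.symm.trans jR1.fst - 4 * σ₁ * rG
  have r22 : m₃ + m₅ + 2 * (B * H) - 2 * G ^ 2 = -4 * S₂₂ + 16 * σ₂ ^ 2 := by
    linear_combination jΔ2.snd.symm.trans jR2.fst - 4 * σ₂ * rH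
  have r12 : m₂ + m₄ + A * H - B * G = -4 * S₁₂ + 16 * (σ₁ * σ₂) := by
    have o := fun {φ : (Fin 2 → ℝ) → ℝ} (hφ : ContDiffOn ℝ (⊤ : ℕ∞) φ U) =>
      HasJet.of_smooth hU hx hφ e₁
    have dfr : ∀ {φ : (Fin 2 → ℝ) → ℝ}, ContDiffOn ℝ (⊤ : ℕ∞) φ U → ∀ y ∈ U,
      DifferentiableAt ℝ φ y := fun hφ y hy => differentiableAt_of_smoothOn hU hφ hy
    have key := ((((o (sm e₁ hbS)).mul jc1).add (ja1.mul (o (sm e₂ hcS)))).sub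
      (((o (sm e₁ hcS)).mul jb1).add (jb1.mul (o (sm e₁ hcS))))).congr
      (ψ := dird e₂ (fun y => dird e₁ (dird e₁ f) y * dird e₂ (dird e₂ f) y
        - dird e₁ (dird e₂ f) y * dird e₁ (dird e₂ f) y)) (fun y hy => by
        rw [dird_sub (dfr (haS.mul hcS) y hy) (dfr (hbS.mul hbS) y hy),
          dird_mul (dfr haS y hy) (dfr hcS y hy), dird_mul (dfr hbS y hy) (dfr hbS y hy),
          cm₂ hf y hy, cm hF2 y hy])
    have e := key.fst.symm.trans jR12.fst
    rw [hm₂, hB, hH, hG, show dird e₁ (dird e₂ (dird e₂ (dird e₂ f))) x = m₄ by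
      rw [← cm hcS x hx, ← dird_congr hU (cm hF2) e₂ hx, hm₄]] at e
    linear_combination e - 4 * σ₂ * rG
  have rS : S₁₁ + S₂₂ = -(3 + β) * (σ₁ ^ 2 + σ₂ ^ 2) := by
    have e := I₄ x hx
    rw [ha, hb, hc, hS₁₁, hS₁₂, hS₂₂, hσ₁, hσ₂] at e
    linear_combination e
  have rI : ∀ v, HasJet U v x (fun y => dird e₂ (dird e₂ f) y * dird e₁ (dird e₁ S) y
        - 2 * (dird e₁ (dird e₂ f) y * dird e₁ (dird e₂ S) y)
        + dird e₁ (dird e₁ f) y * dird e₂ (dird e₂ S) y) _ _ _ := fun v =>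
    (((HasJet.of_smooth hU hx hcS v).mul (HasJet.of_smooth hU hx (sm e₁ hS1) v)).sub
      (((HasJet.of_smooth hU hx hbS v).mul (HasJet.of_smooth hU hx (sm e₁ hS2) v)).const_mul 2)).add
      ((HasJet.of_smooth hU hx haS v).mul (HasJet.of_smooth hU hx (sm e₂ hS2) v))
  have ru1 : G * S₁₁ - 2 * (B * S₁₂) + A * S₂₂ + u₁ + u₃ =
      -(3 + β) * (G * σ₁ ^ 2 - 2 * (B * σ₁ * σ₂) + A * σ₂ ^ 2 + 2 * (σ₁ * S₁₁ + σ₂ * S₁₂)) := by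
    have e := (rI e₁).fst.symm.trans (((((jc1.mul (js11.mul js11)).sub
      ((jb1.mul (js11.mul js21)).const_mul 2)).add (ja1.mul (js21.mul js21))).const_mul
      (-(3 + β))).congr I₄).fst
    rw [ha, hb, hc, hA, hB, hG, hS₁₁, hS₁₂, hS₂₂, hu₁, hu₂, hu₃] at e
    linear_combination e
  have ru2 : H * S₁₁ - 2 * (G * S₁₂) + B * S₂₂ + u₂ + u₄ =
      -(3 + β) * (H * σ₁ ^ 2 - 2 * (G * σ₁ * σ₂) + B * σ₂ ^ 2 + 2 * (σ₁ * S₁₂ + σ₂ * S₂₂)) := by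
    have e := (rI e₂).fst.symm.trans (((((jc2.mul (js12.mul js12)).sub
      ((jb2.mul (js12.mul js22)).const_mul 2)).add (ja2.mul (js22.mul js22))).const_mul
      (-(3 + β))).congr I₄).fst
    rw [ha, hb, hc, ja2.fst, jb2.fst, hH, hS₁₁, hS₁₂, hS₂₂, cm₂ hS x hx, cm hS2 x hx, hu₂, hu₃,
      hu₄] at e
    linear_combination e
  have jΦ1 := HasJet.of_smooth hU hx hΦ e₁
  have jΦ2 := HasJet.of_smooth hU hx hΦ e₂
  have jQ1 := HasJet.of_smooth hU hx hQ e₁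
  have jQ2 := HasJet.of_smooth hU hx hQ e₂
  obtain ⟨p0, p1, p11⟩ := HasJet.quadratic jΦ1 ja1 jb1 jc1 js11 js21 I₁
  obtain ⟨-, p2, p22⟩ := HasJet.quadratic jΦ2 ja2 jb2 jc2 js12 js22 I₁
  obtain ⟨q0, q1, q11⟩ := HasJet.quadratic jQ1 ja1 jb1 jc1 jF11 jF21 I₂
  obtain ⟨-, q2, q22⟩ := HasJet.quadratic jQ2 ja2 jb2 jc2 jF12 jF22 I₂
  obtain ⟨s, hs⟩ : ∃ s, s = S₁₁ - (A * σ₁ + B * σ₂) / 2 + (1 + β) * (σ₁ ^ 2 + σ₂ ^ 2) / 2 :=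
    ⟨_, rfl⟩
  obtain ⟨t, ht⟩ : ∃ t, t = S₁₂ - (B * σ₁ + G * σ₂) / 2 := ⟨_, rfl⟩
  obtain ⟨gΦ₁, gΦ₂, lΦ⟩ := frame_Phi rG rH r11 r22 r12 rS ru1 ru2 hs ht p0 p1 p2 p11 p22
  have jz1 := (HasJet.const hU hx e₁ C').sub jf1
  have jz2 := (HasJet.const hU hx e₂ C').sub jf2
  have hz' : ∀ y ∈ U, C' - f y ≠ 0 := fun y hy => (hz y hy).ne'
  have jℓ1 := jQ1.mul ((jz1.inv hz').mul (jz1.inv hz'))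
  have jℓ2 := jQ2.mul ((jz2.inv hz').mul (jz2.inv hz'))
  have jh1 : HasJet U e₁ x h (h x) X₁ (1 + X₁ * A + X₂ * B) := by
    have j := (((HasJet.const hU hx e₁ d).add ((jξ₁₁.mul jF11).add (jξ₁₂.mul jF21))).sub
      jf1).congr hh
    exact ⟨hU, hx, j.smooth, rfl, j.fst.trans (by ring), j.snd.trans (by ring)⟩
  have jh2 : HasJet U e₂ x h (h x) X₂ (1 + X₁ * G + X₂ * H) := by
    have j := (((HasJet.const hU hx e₂ d).add ((jξ₂₁.mul jF12).add (jξ₂₂.mul jF22))).sub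
      jf2).congr hh
    exact ⟨hU, hx, j.smooth, rfl, j.fst.trans (by ring), j.snd.trans (by ring)⟩
  have hxh : h x = d + X₁ * q - f x := by
    rw [hh x hx, hq, hF₂, jξ₁₁.val]; ring
  have jP1 := jΦ1.add (jℓ1.const_mul μ)
  have jP2 := jΦ2.add (jℓ2.const_mul μ)
  have hP0' := fun y hy => (hP0 y hy).ne'
  have hh0' := fun y hy => (hh0 y hy).ne'
  have jM1 := ((jP1.log hP0').add ((jz1.log hz').const_mul k)).sub
    ((jS1.add (jh1.log hh0')).const_mul α)
  have jM2 := ((jP2.log hP0').add ((jz2.log hz').const_mul k)).sub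
    ((jS2.add (jh2.log hh0')).const_mul α)
  have m1 := jM1.fst.symm.trans (dird_eq_zero_of_isLocalMax hmax e₁)
  have m2 := jM2.fst.symm.trans (dird_eq_zero_of_isLocalMax hmax e₂)
  have m11 := jM1.snd.symm.le.trans (dird_dird_nonpos_of_isLocalMax hU jM1.smooth hx hmax e₁)
  have m22 := jM2.snd.symm.le.trans (dird_dird_nonpos_of_isLocalMax hU jM2.smooth hx hmax e₂)
  clear jM1 jM2 jP1 jP2 jh1 jh2 rI jR1 jR2 jR12 jΔ1 jΔ2 jz1 jz2
  have hP0x := hP0 x hx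
  have hy0 : 0 < (C' - f x)⁻¹ := inv_pos.2 (hz x hx)
  have hh0x := hh0 x hx
  simp only [div_eq_mul_inv _ (C' - f x)] at m1 m2 m11 m22
  generalize dird e₁ Φ x = Φ₁ at *
  generalize dird e₂ Φ x = Φ₂ at *
  generalize dird e₁ (dird e₁ Φ) x = Φ₁₁ at *
  generalize dird e₂ (dird e₂ Φ) x = Φ₂₂ at *
  generalize dird e₁ Q x = Q₁ at *
  generalize dird e₂ Q x = Q₂ at *
  generalize dird e₁ (dird e₁ Q) x = Q₁₁ at *
  generalize dird e₂ (dird e₂ Q) x = Q₂₂ at *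
  generalize (C' - f x)⁻¹ = y at *
  obtain ⟨P, hP⟩ : ∃ P, P = Φ x + μ * (Q x * (y * y)) := ⟨_, rfl⟩
  rw [← hP] at m1 m2 m11 m22 hP0x ⊢
  obtain ⟨ℓ₁, hℓ₁⟩ : ∃ l, l = Q₁ * y ^ 2 + 2 * Q x * q * y ^ 3 := ⟨_, rfl⟩
  obtain ⟨ℓ₂, hℓ₂⟩ : ∃ l, l = Q₂ * y ^ 2 := ⟨_, rfl⟩
  obtain ⟨ℓ₁₁, hℓ₁₁⟩ : ∃ l, l = Q₁₁ * y ^ 2 + 4 * Q₁ * q * y ^ 3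
    + Q x * (6 * q ^ 2 * y ^ 4 + 2 * y ^ 3) := ⟨_, rfl⟩
  obtain ⟨ℓ₂₂, hℓ₂₂⟩ : ∃ l, l = Q₂₂ * y ^ 2 + 2 * Q x * y ^ 3 := ⟨_, rfl⟩
  obtain ⟨n, hn⟩ : ∃ n, n = q * y := ⟨_, rfl⟩
  obtain ⟨gℓ₁, gℓ₂, lℓ⟩ := frame_gradient rG r11 hs p0 (q0.trans (by ring)) (q1.trans (by ring))
    (q2.trans (by ring)) (q11.trans (by ring)) (q22.trans (by ring)) hn hℓ₁ hℓ₂ hℓ₁₁ hℓ₂₂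
  obtain ⟨τ₁, hτ₁⟩ : ∃ τ, τ = X₁ / h x := ⟨_, rfl⟩
  obtain ⟨τ₂, hτ₂⟩ : ∃ τ, τ = X₂ / h x := ⟨_, rfl⟩
  have T1 : (Φ₁ + μ * ℓ₁) / P = k * n + α * (σ₁ + τ₁) := by
    rw [hℓ₁, hτ₁, hn]; linear_combination m1
  have T2 : (Φ₂ + μ * ℓ₂) / P = α * (σ₂ + τ₂) := by
    rw [hℓ₂, hτ₂]; linear_combination m2
  have T1' : Φ₁ + μ * ℓ₁ = P * (k * n + α * (σ₁ + τ₁)) := by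
    rw [← T1]; field_simp
  have T2' : Φ₂ + μ * ℓ₂ = P * (α * (σ₂ + τ₂)) := by
    rw [← T2]; field_simp
  have hPn : P = σ₁ ^ 2 + σ₂ ^ 2 + μ * n ^ 2 := by
    rw [hP, p0, q0, hn]; ring
  have second : (Φ₁₁ + Φ₂₂ + μ * (ℓ₁₁ + ℓ₂₂)) / P
      - ((k * n + α * (σ₁ + τ₁)) ^ 2 + (α * (σ₂ + τ₂)) ^ 2) + k * (-2 * y - n ^ 2)
      - α * (-(3 + β) * (σ₁ ^ 2 + σ₂ ^ 2) + 2 * (1 / h x) - 4 * (σ₁ * τ₁ + σ₂ * τ₂)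
        - (τ₁ ^ 2 + τ₂ ^ 2)) ≤ 0 := by
    have e : α * ((A + G + 4 * σ₁) * τ₁ + (B + H + 4 * σ₂) * τ₂) = 0 := by
      rw [rG, rH]; ring
    rw [← T1, ← T2, ← rS]
    rw [hℓ₁, hℓ₂, hℓ₁₁, hℓ₂₂, hn]
    rw [hτ₁, hτ₂] at e ⊢
    linear_combination m11 + m22 + e
  have h3 := mul_nonpos_of_nonneg_of_nonpos hP0x.le second
  have hΔ : P * ((Φ₁₁ + Φ₂₂ + μ * (ℓ₁₁ + ℓ₂₂)) / P) = Φ₁₁ + Φ₂₂ + μ * (ℓ₁₁ + ℓ₂₂) := by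
    field_simp
  refine le_of_second_order_condition (n := n) (h := h x) (p := σ₁) (q := σ₂) (A := A) (B := B)
    (s := s) (t := t) (ν₁ := σ₁ + τ₁) (ν₂ := σ₂ + τ₂) hβ hα hk hμ hPn hP0x hy0 hc₁ hc₂ ?_ ?_ ?_
    hhz ?_
  · rw [← T1', gΦ₁, gℓ₁, p0]
  · rw [← T2', gΦ₂, gℓ₂, p0]
  · have e : n * σ₁ - n * (σ₁ + τ₁) = -(((h x - d + f x) / h x) * y) := by
      rw [hn, hτ₁, hxh]; ring
    rw [e, abs_neg, abs_mul, abs_of_pos hy0, abs_div, abs_of_pos hh0x]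
    exact mul_le_mul_of_nonneg_right ((div_le_iff₀ hh0x).2 hfh) hy0.le
  · rw [p0] at lΦ
    rw [p0] at lℓ
    linear_combination h3 - hΔ - lΦ - μ * lℓ + 2 * σ₁ * T1' + 2 * σ₂ * T2'

end FrameEstimate

section Coordinates

/-- The determinant of the Hessian of a function on the plane. -/
noncomputable def hdet (f : (Fin 2 → ℝ) → ℝ) (x : Fin 2 → ℝ) : ℝ :=
  pd 0 (pd 0 f) x * pd 1 (pd 1 f) x - pd 0 (pd 1 f) x * pd 0 (pd 1 f) x

/-- The logarithm of `ρ`. -/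
noncomputable def logRho (f : (Fin 2 → ℝ) → ℝ) (x : Fin 2 → ℝ) : ℝ := Real.log (rho f x)

variable {Ω : Set (Fin 2 → ℝ)} {f h : (Fin 2 → ℝ) → ℝ} {x : Fin 2 → ℝ}

lemma contDiffOn_pd (hΩ : IsOpen Ω) (hf : ContDiffOn ℝ (⊤ : ℕ∞) f Ω) (i : Fin 2) :
    ContDiffOn ℝ (⊤ : ℕ∞) (pd i f) Ω := contDiffOn_dird hΩ hf _

lemma pd_comm (hΩ : IsOpen Ω) (hf : ContDiffOn ℝ (⊤ : ℕ∞) f Ω) (i j : Fin 2) (hx : x ∈ Ω) :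
    pd i (pd j f) x = pd j (pd i f) x := dird_comm hΩ hf _ _ hx

lemma contDiffOn_hdet (hΩ : IsOpen Ω) (hf : ContDiffOn ℝ (⊤ : ℕ∞) f Ω) :
    ContDiffOn ℝ (⊤ : ℕ∞) (hdet f) Ω := by
  have h2 := fun i j => contDiffOn_pd hΩ (contDiffOn_pd hΩ hf i) j
  exact ((h2 0 0).mul (h2 1 1)).sub ((h2 1 0).mul (h2 1 0))

lemma det_hess (hΩ : IsOpen Ω) (hf : ContDiffOn ℝ (⊤ : ℕ∞) f Ω) (hx : x ∈ Ω) :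
    (hess f x).det = hdet f x := by
  simp [Matrix.det_fin_two, hess, hdet, pd_comm hΩ hf 1 0 hx]

lemma hdet_pos (hΩ : IsOpen Ω) (hf : ContDiffOn ℝ (⊤ : ℕ∞) f Ω)
    (hp : ∀ x ∈ Ω, (hess f x).PosDef) (hx : x ∈ Ω) : 0 < hdet f x :=
  det_hess hΩ hf hx ▸ (hp x hx).det_pos

lemma inv_hess (hΩ : IsOpen Ω) (hf : ContDiffOn ℝ (⊤ : ℕ∞) f Ω) (hx : x ∈ Ω) :
    (hess f x)⁻¹ = (hdet f x)⁻¹ •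
      !![pd 1 (pd 1 f) x, -pd 0 (pd 1 f) x; -pd 0 (pd 1 f) x, pd 0 (pd 0 f) x] := by
  rw [Matrix.inv_def, Matrix.adjugate_fin_two, det_hess hΩ hf hx, Ring.inverse_eq_inv']
  simp [hess, pd_comm hΩ hf 1 0 hx]

lemma gradSq_eq (hΩ : IsOpen Ω) (hf : ContDiffOn ℝ (⊤ : ℕ∞) f Ω) (hx : x ∈ Ω) :
    gradSq f h x = (pd 1 (pd 1 f) x * (pd 0 h x * pd 0 h x)
      - 2 * (pd 0 (pd 1 f) x * (pd 0 h x * pd 1 h x))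
      + pd 0 (pd 0 f) x * (pd 1 h x * pd 1 h x)) / hdet f x := by
  simp only [gradSq, Fin.sum_univ_two, inv_hess hΩ hf hx]
  simp
  ring

lemma contDiffOn_gradSq (hΩ : IsOpen Ω) (hf : ContDiffOn ℝ (⊤ : ℕ∞) f Ω)
    (hp : ∀ x ∈ Ω, (hess f x).PosDef) (hh : ContDiffOn ℝ (⊤ : ℕ∞) h Ω) :
    ContDiffOn ℝ (⊤ : ℕ∞) (gradSq f h) Ω := by
  have h2 := fun i j => contDiffOn_pd hΩ (contDiffOn_pd hΩ hf i) j
  have h1 := fun i => contDiffOn_pd hΩ hh i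
  refine ContDiffOn.congr ?_ fun y hy => gradSq_eq hΩ hf hy
  exact ((((h2 1 1).mul ((h1 0).mul (h1 0))).sub
    (contDiffOn_const.mul ((h2 1 0).mul ((h1 0).mul (h1 1))))).add
    ((h2 0 0).mul ((h1 1).mul (h1 1)))).div (contDiffOn_hdet hΩ hf)
    fun y hy => (hdet_pos hΩ hf hp hy).ne'

lemma gradSq_nonneg (hp : (hess f x).PosDef) : 0 ≤ gradSq f h x := by
  have e := hp.inv.posSemidef.dotProduct_mulVec_nonneg (gradv h x)
  simp only [star_trivial] at e
  refine e.trans_eq ?_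
  simp only [gradSq, dotProduct, Matrix.mulVec, Fin.sum_univ_two, gradv]
  ring

lemma rho_eq (hΩ : IsOpen Ω) (hf : ContDiffOn ℝ (⊤ : ℕ∞) f Ω) (hx : x ∈ Ω) :
    rho f x = hdet f x ^ (-(1 / 4) : ℝ) := by
  rw [rho, det_hess hΩ hf hx]
  norm_num

lemma rho_pos (hΩ : IsOpen Ω) (hf : ContDiffOn ℝ (⊤ : ℕ∞) f Ω)
    (hp : ∀ x ∈ Ω, (hess f x).PosDef) (hx : x ∈ Ω) : 0 < rho f x := by
  rw [rho_eq hΩ hf hx]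
  exact Real.rpow_pos_of_pos (hdet_pos hΩ hf hp hx) _

lemma logRho_eq (hΩ : IsOpen Ω) (hf : ContDiffOn ℝ (⊤ : ℕ∞) f Ω)
    (hp : ∀ x ∈ Ω, (hess f x).PosDef) (hx : x ∈ Ω) :
    logRho f x = -(1 / 4) * Real.log (hdet f x) := by
  rw [logRho, rho_eq hΩ hf hx, Real.log_rpow (hdet_pos hΩ hf hp hx)]

lemma contDiffOn_logRho (hΩ : IsOpen Ω) (hf : ContDiffOn ℝ (⊤ : ℕ∞) f Ω)
    (hp : ∀ x ∈ Ω, (hess f x).PosDef) : ContDiffOn ℝ (⊤ : ℕ∞) (logRho f) Ω :=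
  (contDiffOn_const.mul ((contDiffOn_hdet hΩ hf).log fun _ hy =>
    (hdet_pos hΩ hf hp hy).ne')).congr fun _ hy => logRho_eq hΩ hf hp hy

lemma dird_hdet (hΩ : IsOpen Ω) (hf : ContDiffOn ℝ (⊤ : ℕ∞) f Ω)
    (hp : ∀ x ∈ Ω, (hess f x).PosDef) (v : Fin 2 → ℝ) (hx : x ∈ Ω) :
    dird v (hdet f) x = -4 * (hdet f x * dird v (logRho f) x) := by
  have hD := contDiffOn_hdet hΩ hf
  have h0 := fun y hy => (hdet_pos hΩ hf hp (x := y) hy).ne'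
  rw [dird_congr hΩ (fun _ hy => logRho_eq hΩ hf hp hy) v hx,
    dird_const_mul (differentiableAt_of_smoothOn hΩ (hD.log h0) hx),
    ← dird_log (differentiableAt_of_smoothOn hΩ hD hx) (h0 x hx)]
  ring

lemma dird_exp (hφ : DifferentiableAt ℝ h x) (v : Fin 2 → ℝ) :
    dird v (fun y => Real.exp (h y)) x = Real.exp (h x) * dird v h x := by
  simp only [dird]
  rw [fderiv_exp hφ]
  simp

lemma rho_eq_exp (hΩ : IsOpen Ω) (hf : ContDiffOn ℝ (⊤ : ℕ∞) f Ω)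
    (hp : ∀ x ∈ Ω, (hess f x).PosDef) (hx : x ∈ Ω) : rho f x = Real.exp (logRho f x) := by
  rw [logRho, Real.exp_log (rho_pos hΩ hf hp hx)]

lemma pd_rho (hΩ : IsOpen Ω) (hf : ContDiffOn ℝ (⊤ : ℕ∞) f Ω)
    (hp : ∀ x ∈ Ω, (hess f x).PosDef) (i : Fin 2) (hx : x ∈ Ω) :
    pd i (rho f) x = rho f x * pd i (logRho f) x := by
  have hS := differentiableAt_of_smoothOn hΩ (contDiffOn_logRho hΩ hf hp) hx
  rw [rho_eq_exp hΩ hf hp hx]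
  exact (dird_congr hΩ (fun y hy => rho_eq_exp hΩ hf hp hy) _ hx).trans (dird_exp hS _)

lemma gradSq_rho (hΩ : IsOpen Ω) (hf : ContDiffOn ℝ (⊤ : ℕ∞) f Ω)
    (hp : ∀ x ∈ Ω, (hess f x).PosDef) (hx : x ∈ Ω) :
    gradSq f (rho f) x = rho f x ^ 2 * gradSq f (logRho f) x := by
  simp only [gradSq_eq hΩ hf hx, pd_rho hΩ hf hp _ hx]
  ring

lemma Phi_eq (hΩ : IsOpen Ω) (hf : ContDiffOn ℝ (⊤ : ℕ∞) f Ω)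
    (hp : ∀ x ∈ Ω, (hess f x).PosDef) (hx : x ∈ Ω) : Phi f x = gradSq f (logRho f) x := by
  have := (rho_pos hΩ hf hp hx).ne'
  rw [Phi, gradSq_rho hΩ hf hp hx]
  field_simp

/-- The equation for `ρ` written in terms of `log ρ` and the cofactor matrix of the Hessian. -/
lemma PDE2.cofactor {β : ℝ} (hpde : PDE2 f β Ω) (hΩ : IsOpen Ω) (hf : ContDiffOn ℝ (⊤ : ℕ∞) f Ω)
    (hp : ∀ x ∈ Ω, (hess f x).PosDef) (hx : x ∈ Ω) :
    pd 1 (pd 1 f) x * pd 0 (pd 0 (logRho f)) x - 2 * (pd 0 (pd 1 f) x * pd 0 (pd 1 (logRho f)) x)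
        + pd 0 (pd 0 f) x * pd 1 (pd 1 (logRho f)) x =
      -(3 + β) * (pd 1 (pd 1 f) x * (pd 0 (logRho f) x * pd 0 (logRho f) x)
        - 2 * (pd 0 (pd 1 f) x * (pd 0 (logRho f) x * pd 1 (logRho f) x))
        + pd 0 (pd 0 f) x * (pd 1 (logRho f) x * pd 1 (logRho f) x)) := by
  have hS := contDiffOn_logRho hΩ hf hp
  have h2 := fun i j => contDiffOn_pd hΩ (contDiffOn_pd hΩ hf i) j
  have h1 := fun i => contDiffOn_pd hΩ hS i
  have hD : ∀ y ∈ Ω, hdet f y = Real.exp (-4 * logRho f y) := fun y hy => by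
    rw [logRho_eq hΩ hf hp hy]
    ring_nf
    exact (Real.exp_log (hdet_pos hΩ hf hp hy)).symm
  have hsq : ∀ y ∈ Ω, Real.sqrt (hess f y).det = Real.exp (-2 * logRho f y) := fun y hy => by
    rw [det_hess hΩ hf hy, hD y hy, ← Real.exp_half]
    ring_nf
  obtain ⟨w, hw⟩ : ∃ w : (Fin 2 → ℝ) → ℝ, w = fun y => Real.exp (3 * logRho f y) := ⟨_, rfl⟩
  have hws : ContDiffOn ℝ (⊤ : ℕ∞) w Ω := by
    rw [hw]; exact (contDiffOn_const.mul hS).exp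
  have hwd : ∀ i, pd i w x = w x * (3 * pd i (logRho f) x) := fun i => by
    have d := differentiableAt_of_smoothOn hΩ hS hx
    rw [hw]
    exact (dird_exp (d.const_mul 3) _).trans (by rw [dird_const_mul d]; rfl)
  have flux : ∀ (i j : Fin 2) (a : (Fin 2 → ℝ) → ℝ), ContDiffOn ℝ (⊤ : ℕ∞) a Ω →
      (∀ y ∈ Ω, (hess f y)⁻¹ i j = (hdet f y)⁻¹ * a y) →
      pd i (fun y => Real.sqrt (hess f y).det * (hess f y)⁻¹ i j * pd j (rho f) y) x =
        w x * (3 * pd i (logRho f) x * (a x * pd j (logRho f) x) + pd i a x * pd j (logRho f) x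
          + a x * pd i (pd j (logRho f)) x) := fun i j a ha hinv => by
    have dd : ∀ {φ : (Fin 2 → ℝ) → ℝ}, ContDiffOn ℝ (⊤ : ℕ∞) φ Ω → DifferentiableAt ℝ φ x :=
      fun h => differentiableAt_of_smoothOn hΩ h hx
    have e : ∀ y ∈ Ω, Real.sqrt (hess f y).det * (hess f y)⁻¹ i j * pd j (rho f) y =
        w y * (a y * pd j (logRho f) y) := fun y hy => by
      rw [hsq y hy, hinv y hy, hD y hy, pd_rho hΩ hf hp j hy, rho_eq_exp hΩ hf hp hy, hw,
        ← Real.exp_neg]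
      have : Real.exp (3 * logRho f y) =
          Real.exp (-2 * logRho f y) * Real.exp (-(-4 * logRho f y)) * Real.exp (logRho f y) := by
        rw [← Real.exp_add, ← Real.exp_add]; ring_nf
      simp only [this]
      ring
    have e1 := dird_congr hΩ e (Pi.single i 1) hx
    rw [dird_mul (dd hws) (dd (ha.mul (h1 j))), dird_mul (dd ha) (dd (h1 j))] at e1
    have e2 := hwd i
    simp only [pd] at e1 e2 ⊢
    simp only [dird] at e1
    rw [e1, e2]
    ring
  have key := hpde x hx
  rw [gradSq_rho hΩ hf hp hx, gradSq_eq hΩ hf hx, calabiLap] at key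
  simp only [Fin.sum_univ_two] at key
  have i0 := fun y hy => inv_hess hΩ hf (x := y) hy
  rw [flux 0 0 (pd 1 (pd 1 f)) (h2 1 1) fun y hy => by rw [i0 y hy]; simp,
    flux 0 1 (fun y => -pd 0 (pd 1 f) y) (h2 1 0).neg fun y hy => by rw [i0 y hy]; simp,
    flux 1 0 (fun y => -pd 0 (pd 1 f) y) (h2 1 0).neg fun y hy => by rw [i0 y hy]; simp,
    flux 1 1 (pd 0 (pd 0 f)) (h2 0 0) fun y hy => by rw [i0 y hy]; simp] at key
  have n : ∀ i, pd i (fun y => -pd 0 (pd 1 f) y) x = -pd i (pd 0 (pd 1 f)) x := fun i => by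
    simp only [pd]; rw [fderiv_fun_neg]; rfl
  have d0 : pd 0 (pd 1 (pd 1 f)) x = pd 1 (pd 0 (pd 1 f)) x :=
    pd_comm hΩ (contDiffOn_pd hΩ hf 1) 0 1 hx
  have d1 : pd 1 (pd 0 (pd 0 f)) x = pd 0 (pd 0 (pd 1 f)) x :=
    (pd_comm hΩ (contDiffOn_pd hΩ hf 0) 1 0 hx).trans
      (dird_congr hΩ (fun y hy => pd_comm hΩ hf 1 0 hy) _ hx)
  rw [n, n, d0, d1, pd_comm hΩ hS 1 0 hx, hsq x hx, hD x hx, rho_eq_exp hΩ hf hp hx, hw] at key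
  have e3 : Real.exp (3 * logRho f x) = Real.exp (logRho f x) ^ 3 := by
    rw [← Real.exp_nat_mul]; norm_num
  have e2 : Real.exp (-2 * logRho f x) = (Real.exp (logRho f x) ^ 2)⁻¹ := by
    rw [← Real.exp_nat_mul, ← Real.exp_neg]; norm_num
  have e4 : Real.exp (-4 * logRho f x) = (Real.exp (logRho f x) ^ 4)⁻¹ := by
    rw [← Real.exp_nat_mul, ← Real.exp_neg]; norm_num
  simp only [e3, e2, e4] at key
  have hE := Real.exp_pos (logRho f x)
  generalize Real.exp (logRho f x) = E at key hE
  have hE5 : E ^ 5 ≠ 0 := by positivity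
  refine mul_left_cancel₀ hE5 ?_
  field_simp at key
  linear_combination E ^ 5 * key
end Coordinates

section FrameChange

/-- A basis of the plane orthonormal for a given inner product, whose second vector is orthogonal
to a given covector. -/
lemma exists_adapted_frame {a b c : ℝ} (ha : 0 < a) (hD : 0 < a * c - b * b) (g₀ g₁ : ℝ) :
    ∃ p q r s : ℝ, a * p ^ 2 + 2 * b * p * q + c * q ^ 2 = 1 ∧
      a * p * r + b * (p * s + q * r) + c * q * s = 0 ∧
      a * r ^ 2 + 2 * b * r * s + c * s ^ 2 = 1 ∧ r * g₀ + s * g₁ = 0 := by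
  obtain ⟨v, w, hvw, hg⟩ : ∃ v w : ℝ, (v ≠ 0 ∨ w ≠ 0) ∧ v * g₀ + w * g₁ = 0 := by
    by_cases h : g₀ = 0
    · exact ⟨1, 0, Or.inl one_ne_zero, by simp [h]⟩
    · exact ⟨-g₁, g₀, Or.inr h, by ring⟩
  obtain ⟨N, hN⟩ : ∃ N, N = a * v ^ 2 + 2 * b * v * w + c * w ^ 2 := ⟨_, rfl⟩
  have hN0 : 0 < N := by
    have e : a * N = (a * v + b * w) ^ 2 + (a * c - b * b) * w ^ 2 := by rw [hN]; ring
    refine pos_of_mul_pos_right (e ▸ ?_) ha.le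
    by_cases hw : w = 0
    · have hv : v ≠ 0 := by tauto
      rw [hw]
      have := mul_ne_zero ha.ne' hv
      simpa using by positivity
    · exact add_pos_of_nonneg_of_pos (sq_nonneg _) (mul_pos hD (by positivity))
  obtain ⟨k, hk0, hk⟩ : ∃ k : ℝ, 0 < k ∧ k ^ 2 = N := ⟨√N, Real.sqrt_pos.2 hN0, Real.sq_sqrt hN0.le⟩
  obtain ⟨l, hl0, hl⟩ : ∃ l : ℝ, 0 < l ∧ l ^ 2 = a * c - b * b :=
    ⟨√(a * c - b * b), Real.sqrt_pos.2 hD, Real.sq_sqrt hD.le⟩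
  refine ⟨-(b * v + c * w) / (k * l), (a * v + b * w) / (k * l), v / k, w / k, ?_, ?_, ?_, ?_⟩
  · field_simp
    rw [hk, hl, hN]; ring
  · field_simp
    ring
  · field_simp
    rw [hk, hN]; ring
  · field_simp
    linear_combination hg

variable {Ω U : Set (Fin 2 → ℝ)} {f φ : (Fin 2 → ℝ) → ℝ} {x : Fin 2 → ℝ}

lemma dird_eq (v x : Fin 2 → ℝ) : dird v φ x = v 0 * pd 0 φ x + v 1 * pd 1 φ x := by
  have e : v = v 0 • Pi.single 0 1 + v 1 • Pi.single 1 1 := by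
    ext i; fin_cases i <;> simp
  simp only [dird, pd]
  conv_lhs => rw [e, map_add, map_smul, map_smul]
  simp only [smul_eq_mul]

lemma dird_dird_eq (hΩ : IsOpen Ω) (hφ : ContDiffOn ℝ (⊤ : ℕ∞) φ Ω) (v w : Fin 2 → ℝ)
    (hx : x ∈ Ω) : dird v (dird w φ) x = v 0 * w 0 * pd 0 (pd 0 φ) x
      + (v 0 * w 1 + v 1 * w 0) * pd 0 (pd 1 φ) x + v 1 * w 1 * pd 1 (pd 1 φ) x := by
  have h1 := fun i => contDiffOn_pd hΩ hφ i
  have dd : ∀ i, DifferentiableAt ℝ (pd i φ) x := fun i =>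
    differentiableAt_of_smoothOn hΩ (h1 i) hx
  rw [dird_congr hΩ (ψ := fun y => w 0 * pd 0 φ y + w 1 * pd 1 φ y) (fun y _ => dird_eq w y) v hx,
    dird_add ((dd 0).const_mul _) ((dd 1).const_mul _), dird_const_mul (dd 0),
    dird_const_mul (dd 1), dird_eq, dird_eq, pd_comm hΩ hφ 1 0 hx]
  ring

lemma HasJet.linear (hU : IsOpen U) (hx : x ∈ U) (v : Fin 2 → ℝ) (a b : ℝ) :
    HasJet U v x (fun y => a * y 0 + b * y 1) (a * x 0 + b * x 1) (a * v 0 + b * v 1) 0 := by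
  have d : ∀ (i : Fin 2) (y : Fin 2 → ℝ), HasFDerivAt (fun y : Fin 2 → ℝ => y i)
      (ContinuousLinearMap.proj (R := ℝ) i) y := fun i y => hasFDerivAt_apply i y
  have e : dird v (fun y : Fin 2 → ℝ => a * y 0 + b * y 1) = fun _ => a * v 0 + b * v 1 := by
    ext y
    simp only [dird]
    rw [(((d 0 y).const_mul a).fun_add ((d 1 y).const_mul b)).fderiv]
    simp
  exact ⟨hU, hx, by fun_prop, rfl, by rw [e], by rw [e, dird_const]⟩

/-- At an interior local maximum of the logarithm of the test function, the second order condition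
bounds `Φ + μ ‖grad f‖² / (C' - f)²` by a multiple of `1 / (C' - f)`. -/
lemma estimate_at_local_max {α β k μ d c₁ c₂ C' : ℝ} {h : (Fin 2 → ℝ) → ℝ}
    (hΩ : IsOpen Ω) (hf : ContDiffOn ℝ (⊤ : ℕ∞) f Ω) (hp : ∀ x ∈ Ω, (hess f x).PosDef)
    (hpde : PDE2 f β Ω) (hU : IsOpen U) (hUΩ : U ⊆ Ω) (hx : x ∈ U)
    (hh : ∀ y ∈ U, h y = d + (y 0 * pd 0 f y + y 1 * pd 1 f y) - f y)
    (hz : ∀ y ∈ U, 0 < C' - f y) (hh0 : ∀ y ∈ U, 0 < h y)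
    (hP0 : ∀ y ∈ U, 0 < gradSq f (logRho f) y
      + μ * (gradSq f f y * ((C' - f y)⁻¹ * (C' - f y)⁻¹)))
    (hmax : IsLocalMax (fun y =>
      Real.log (gradSq f (logRho f) y + μ * (gradSq f f y * ((C' - f y)⁻¹ * (C' - f y)⁻¹)))
        + k * Real.log (C' - f y) - α * (logRho f y + Real.log (h y))) x)
    (hβ : 0 < β) (hα : 16 + 608 / β ≤ α) (hk : 8 * α ≤ k) (hμ : μ = k ^ 2 / (16 * α))
    (hc₁ : 0 ≤ c₁) (hc₂ : 0 ≤ c₂)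
    (hfh : |h x - d + f x| ≤ c₁ * h x) (hhz : 1 / h x ≤ c₂ * (C' - f x)⁻¹) :
    gradSq f (logRho f) x + μ * (gradSq f f x * ((C' - f x)⁻¹ * (C' - f x)⁻¹)) ≤
      (2 * k * c₁ + 2 * k + 2 * α * c₂ + 300 * μ + 1) * (C' - f x)⁻¹ := by
  have hS := contDiffOn_logRho hΩ hf hp
  have hxΩ := hUΩ hx
  have ha : 0 < pd 0 (pd 0 f) x := by simpa [hess] using (hp x hxΩ).diag_pos (i := 0)
  obtain ⟨p, q, r, s, h1, h2, h3, h4⟩ :=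
    exists_adapted_frame ha (hdet_pos hΩ hf hp hxΩ) (pd 0 f x) (pd 1 f x)
  have hE : (p * s - q * r) ≠ 0 := by
    intro h0
    have e : (p * s - q * r) ^ 2 * hdet f x = 1 := by
      rw [hdet]
      linear_combination h1 * (pd 0 (pd 0 f) x * r ^ 2 + 2 * pd 0 (pd 1 f) x * r * s
        + pd 1 (pd 1 f) x * s ^ 2) + h3 - h2 * (pd 0 (pd 0 f) x * p * r + pd 0 (pd 1 f) x *
        (p * s + q * r) + pd 1 (pd 1 f) x * q * s)
    simp [h0] at e
  obtain ⟨ι, hι⟩ : ∃ ι, ι * (p * s - q * r) = 1 := ⟨_, inv_mul_cancel₀ hE⟩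
  have D1 : ∀ (φ : (Fin 2 → ℝ) → ℝ) y, dird ![p, q] φ y = p * pd 0 φ y + q * pd 1 φ y :=
    fun φ y => dird_eq ![p, q] y
  have D2 : ∀ (φ : (Fin 2 → ℝ) → ℝ) y, dird ![r, s] φ y = r * pd 0 φ y + s * pd 1 φ y :=
    fun φ y => dird_eq ![r, s] y
  have D11 : ∀ {φ : (Fin 2 → ℝ) → ℝ}, ContDiffOn ℝ (⊤ : ℕ∞) φ Ω → ∀ y ∈ U,
      dird ![p, q] (dird ![p, q] φ) y = p * p * pd 0 (pd 0 φ) y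
      + (p * q + q * p) * pd 0 (pd 1 φ) y + q * q * pd 1 (pd 1 φ) y :=
    fun hφ y hy => dird_dird_eq hΩ hφ ![p, q] ![p, q] (hUΩ hy)
  have D12 : ∀ {φ : (Fin 2 → ℝ) → ℝ}, ContDiffOn ℝ (⊤ : ℕ∞) φ Ω → ∀ y ∈ U,
      dird ![p, q] (dird ![r, s] φ) y = p * r * pd 0 (pd 0 φ) y
      + (p * s + q * r) * pd 0 (pd 1 φ) y + q * s * pd 1 (pd 1 φ) y :=
    fun hφ y hy => dird_dird_eq hΩ hφ ![p, q] ![r, s] (hUΩ hy)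
  have D22 : ∀ {φ : (Fin 2 → ℝ) → ℝ}, ContDiffOn ℝ (⊤ : ℕ∞) φ Ω → ∀ y ∈ U,
      dird ![r, s] (dird ![r, s] φ) y = r * r * pd 0 (pd 0 φ) y
      + (r * s + s * r) * pd 0 (pd 1 φ) y + s * s * pd 1 (pd 1 φ) y :=
    fun hφ y hy => dird_dird_eq hΩ hφ ![r, s] ![r, s] (hUΩ hy)
  have gr : ∀ (φ : (Fin 2 → ℝ) → ℝ), ∀ y ∈ U,
      gradSq f φ y * (dird ![p, q] (dird ![p, q] f) y * dird ![r, s] (dird ![r, s] f) y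
        - dird ![p, q] (dird ![r, s] f) y * dird ![p, q] (dird ![r, s] f) y) =
      dird ![r, s] (dird ![r, s] f) y * (dird ![p, q] φ y * dird ![p, q] φ y)
        - 2 * (dird ![p, q] (dird ![r, s] f) y * (dird ![p, q] φ y * dird ![r, s] φ y))
        + dird ![p, q] (dird ![p, q] f) y * (dird ![r, s] φ y * dird ![r, s] φ y) := by
    intro φ y hy
    have e := gradSq_eq (h := φ) hΩ hf (hUΩ hy)
    rw [eq_div_iff (hdet_pos hΩ hf hp (hUΩ hy)).ne', hdet] at e
    simp only [D11 hf y hy, D12 hf y hy, D22 hf y hy, D1, D2]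
    linear_combination (p * s - q * r) ^ 2 * e
  have hΔ : ∀ y ∈ U, dird ![p, q] (dird ![p, q] f) y * dird ![r, s] (dird ![r, s] f) y
        - dird ![p, q] (dird ![r, s] f) y * dird ![p, q] (dird ![r, s] f) y =
      (p * s - q * r) ^ 2 * hdet f y := fun y hy => by
    rw [D11 hf y hy, D12 hf y hy, D22 hf y hy, hdet]
    ring
  have jξ := fun (v : Fin 2 → ℝ) (a b : ℝ) => HasJet.linear hU hx v a b
  refine frame_estimate (e₁ := ![p, q]) (e₂ := ![r, s])
    (ξ₁ := fun y => s * ι * y 0 + -r * ι * y 1) (ξ₂ := fun y => -q * ι * y 0 + p * ι * y 1)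
    (X₁ := _) (X₂ := _) (d := d) hU hx (hf.mono hUΩ) (hS.mono hUΩ)
    ((contDiffOn_gradSq hΩ hf hp hS).mono hUΩ) ((contDiffOn_gradSq hΩ hf hp hf).mono hUΩ)
    (gr _) (gr _) ?_ ?_ ?_ ?_ ?_ ?_ ?_ ⟨hU, hx, (jξ ![p, q] _ _).smooth, rfl, ?_, (jξ _ _ _).snd⟩
    ⟨hU, hx, (jξ ![p, q] _ _).smooth, rfl, ?_, (jξ _ _ _).snd⟩
    ⟨hU, hx, (jξ ![p, q] _ _).smooth, rfl, ?_, (jξ _ _ _).snd⟩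
    ⟨hU, hx, (jξ ![p, q] _ _).smooth, rfl, ?_, (jξ _ _ _).snd⟩ hz hh0 hP0 hmax hβ hα hk hμ hc₁ hc₂
    hfh hhz
  · intro v y hy
    rw [dird_congr hU hΔ v hy, dird_const_mul (differentiableAt_of_smoothOn hΩ
      (contDiffOn_hdet hΩ hf) (hUΩ hy)), dird_hdet hΩ hf hp v (hUΩ hy), hΔ y hy]
    ring
  · intro y hy
    have e := hpde.cofactor hΩ hf hp (hUΩ hy)
    simp only [D11 hf y hy, D12 hf y hy, D22 hf y hy, D11 hS y hy, D12 hS y hy, D22 hS y hy, D1, D2]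
    linear_combination (p * s - q * r) ^ 2 * e
  · intro y hy
    rw [hh y hy, D1, D2]
    linear_combination -(y 0 * pd 0 f y + y 1 * pd 1 f y) * hι
  · rw [D11 hf x hx]
    linear_combination h1
  · rw [D12 hf x hx]
    linear_combination h2
  · rw [D22 hf x hx]
    linear_combination h3
  · rw [D2]
    exact h4
  · rw [(jξ _ _ _).fst]
    simp only [Matrix.cons_val_zero, Matrix.cons_val_one]
    linear_combination hι
  · rw [(jξ _ _ _).fst]
    simp only [Matrix.cons_val_zero, Matrix.cons_val_one]
    ring
  · rw [(jξ _ _ _).fst]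
    simp only [Matrix.cons_val_zero, Matrix.cons_val_one]
    ring
  · rw [(jξ _ _ _).fst]
    simp only [Matrix.cons_val_zero, Matrix.cons_val_one]
    linear_combination hι

end FrameChange

section Convexity

variable {Ω : Set (Fin 2 → ℝ)} {f : (Fin 2 → ℝ) → ℝ} {C : ℝ} {x y : Fin 2 → ℝ}

lemma NormalizedDomain.isCompact_closure (hΩ : NormalizedDomain Ω) : IsCompact (closure Ω) := by
  refine Bornology.IsBounded.isCompact_closure ?_
  refine (Metric.isBounded_closedBall (x := (0 : Fin 2 → ℝ)) (r := 1)).subset fun y hy => ?_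
  have h : y 0 ^ 2 + y 1 ^ 2 < 1 ^ 2 := hΩ.2.2.2 hy
  rw [mem_closedBall_zero_iff, pi_norm_le_iff_of_nonneg zero_le_one]
  intro i
  rw [Real.norm_eq_abs, ← sq_le_one_iff_abs_le_one]
  fin_cases i
  · simp only [Fin.zero_eta]; nlinarith [sq_nonneg (y 1)]
  · simp only [Fin.mk_one]; nlinarith [sq_nonneg (y 0)]

lemma NormalizedDomain.ebal_third_subset (hΩ : NormalizedDomain Ω) : ebal (1 / 3) ⊆ Ω := by
  refine Set.Subset.trans (fun y hy => ?_) hΩ.2.2.1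
  have h : y 0 ^ 2 + y 1 ^ 2 < (1 / 3) ^ 2 := hy
  have e : ((2 : ℝ) ^ (-(3 : ℝ) / 2)) ^ 2 = 1 / 8 := by
    rw [← Real.rpow_natCast, ← Real.rpow_mul (by norm_num)]
    norm_num
  change y 0 ^ 2 + y 1 ^ 2 < ((2 : ℝ) ^ (-(3 : ℝ) / 2)) ^ 2
  rw [e]
  linarith

lemma NormalizedDomain.zero_mem (hΩ : NormalizedDomain Ω) : (0 : Fin 2 → ℝ) ∈ Ω :=
  hΩ.ebal_third_subset (by simp [ebal])

lemma NormalizedDomain.neg_third_mem (hΩ : NormalizedDomain Ω) (hx : x ∈ Ω) :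
    (-(1 / 3) : ℝ) • x ∈ Ω := by
  have h : x 0 ^ 2 + x 1 ^ 2 < 1 ^ 2 := hΩ.2.2.2 hx
  refine hΩ.ebal_third_subset ?_
  change ((-(1 / 3) : ℝ) • x) 0 ^ 2 + ((-(1 / 3) : ℝ) • x) 1 ^ 2 < (1 / 3) ^ 2
  simp only [Pi.smul_apply, smul_eq_mul]
  linarith

lemma dird_dird_nonneg (hΩ : IsOpen Ω) (hf : ContDiffOn ℝ (⊤ : ℕ∞) f Ω)
    (hp : ∀ x ∈ Ω, (hess f x).PosDef) (v : Fin 2 → ℝ) (hx : x ∈ Ω) :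
    0 ≤ dird v (dird v f) x := by
  have e := (hp x hx).posSemidef.dotProduct_mulVec_nonneg v
  simp only [star_trivial] at e
  refine e.trans_eq ?_
  rw [dird_dird_eq hΩ hf v v hx]
  simp only [dotProduct, Matrix.mulVec, Fin.sum_univ_two, hess, Matrix.of_apply,
    pd_comm hΩ hf 1 0 hx]
  ring

/-- A function with positive definite Hessian lies above its tangent planes. -/
lemma tangent_le (hΩ : IsOpen Ω) (hc : Convex ℝ Ω) (hf : ContDiffOn ℝ (⊤ : ℕ∞) f Ω)
    (hp : ∀ x ∈ Ω, (hess f x).PosDef) (hx : x ∈ Ω) (hy : y ∈ Ω) :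
    f x + fderiv ℝ f x (y - x) ≤ f y := by
  obtain ⟨v, hv⟩ : ∃ v, v = y - x := ⟨_, rfl⟩
  have mem : ∀ t ∈ Set.Icc (0 : ℝ) 1, x + t • v ∈ Ω := fun t ht => by
    rw [hv]; exact hc.add_smul_sub_mem hx hy ht
  have d1 : ∀ t ∈ Set.Icc (0 : ℝ) 1,
      HasDerivAt (fun s : ℝ => f (x + s • v)) (dird v f (x + t • v)) t := fun t ht =>
    hasDerivAt_line (differentiableAt_of_smoothOn hΩ hf (mem t ht))
  have d2 : ∀ t ∈ Set.Icc (0 : ℝ) 1,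
      HasDerivAt (fun s : ℝ => dird v f (x + s • v)) (dird v (dird v f) (x + t • v)) t :=
    fun t ht => hasDerivAt_line
      (differentiableAt_of_smoothOn hΩ (contDiffOn_dird hΩ hf v) (mem t ht))
  have mono : MonotoneOn (fun s : ℝ => dird v f (x + s • v)) (Set.Icc 0 1) := by
    refine monotoneOn_of_deriv_nonneg (convex_Icc 0 1)
      (fun t ht => (d2 t ht).continuousAt.continuousWithinAt)
      (fun t ht => (d2 t (interior_subset ht)).differentiableAt.differentiableWithinAt)
      fun t ht => ?_
    rw [(d2 t (interior_subset ht)).deriv]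
    exact dird_dird_nonneg hΩ hf hp v (mem t (interior_subset ht))
  obtain ⟨t, ht, e⟩ := exists_hasDerivAt_eq_slope (fun s : ℝ => f (x + s • v))
    (fun s => dird v f (x + s • v)) zero_lt_one
    (fun t ht => (d1 t ht).continuousAt.continuousWithinAt)
    fun t ht => d1 t (Set.Ioo_subset_Icc_self ht)
  have m := mono (Set.left_mem_Icc.2 zero_le_one) (Set.Ioo_subset_Icc_self ht) ht.1.le
  simp only [zero_smul, add_zero, one_smul, sub_zero, div_one] at e m
  rw [e] at m
  have e2 : x + v = y := by rw [hv]; abel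
  rw [e2] at m
  change f x + fderiv ℝ f x (y - x) ≤ f y
  rw [← hv]
  simp only [dird] at m
  linarith

namespace SClass

lemma tangent_le_closure (hΩ : NormalizedDomain Ω) (hS : SClass Ω C f) (hx : x ∈ Ω)
    (hy : y ∈ closure Ω) : f x + fderiv ℝ f x (y - x) ≤ f y :=
  le_on_closure (f := fun y => f x + fderiv ℝ f x (y - x))
    (fun _ hy => tangent_le hΩ.1 hΩ.2.1 hS.1 hS.2.1 hx hy)
    (by fun_prop) hS.2.2.2.1 hy

lemma nonneg (hΩ : NormalizedDomain Ω) (hS : SClass Ω C f) (hx : x ∈ Ω) : 0 ≤ f x := by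
  rw [← hS.2.2.1]
  exact csInf_le ((hΩ.isCompact_closure.bddBelow_image hS.2.2.2.1).mono
    (Set.image_mono subset_closure)) ⟨x, hx, rfl⟩

lemma lt (hΩ : NormalizedDomain Ω) (hS : SClass Ω C f) (hx : x ∈ Ω) : f x < C := by
  by_contra! hge
  obtain ⟨w, hw, hmax⟩ := hΩ.isCompact_closure.exists_isMaxOn ⟨x, subset_closure hx⟩ hS.2.2.2.1
  obtain ⟨z, hz, hzmax⟩ : ∃ z ∈ Ω, ∀ y ∈ Ω, f y ≤ f z := by
    by_cases hwΩ : w ∈ Ω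
    · exact ⟨w, hwΩ, fun y hy => hmax (subset_closure hy)⟩
    · have hwf : w ∈ frontier Ω := by
        rw [hΩ.1.frontier_eq]; exact ⟨hw, hwΩ⟩
      exact ⟨x, hx, fun y hy => (hmax (subset_closure hy) : f y ≤ f w).trans
        ((hS.2.2.2.2 w hwf).trans_le hge)⟩
  have hloc : IsLocalMax f z := by
    filter_upwards [hΩ.1.mem_nhds hz] with y hy using hzmax y hy
  have h1 := dird_dird_nonpos_of_isLocalMax hΩ.1 hS.1 hz hloc (Pi.single 0 1)
  have h2 : 0 < pd 0 (pd 0 f) z := by simpa [hess] using (hS.2.1 z hz).diag_pos (i := 0)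
  exact absurd h1 (not_le.2 h2)

/-- The value at the origin stays away from the boundary value. -/
lemma zero_value_le (hΩ : NormalizedDomain Ω) (hS : SClass Ω C f) : C / 4 ≤ C - f 0 := by
  refine le_of_forall_pos_le_add fun ε hε => ?_
  obtain ⟨_, ⟨y, hy, rfl⟩, hyε⟩ := exists_lt_of_csInf_lt (Set.Nonempty.image f ⟨0, hΩ.zero_mem⟩)
    (hS.2.2.1.trans_lt hε)
  have t1 := tangent_le hΩ.1 hΩ.2.1 hS.1 hS.2.1 hΩ.zero_mem hy
  have t2 := tangent_le hΩ.1 hΩ.2.1 hS.1 hS.2.1 hΩ.zero_mem (hΩ.neg_third_mem hy)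
  have t3 := hS.lt hΩ (hΩ.neg_third_mem hy)
  simp only [sub_zero, map_smul, smul_eq_mul] at t1 t2
  linarith

end SClass

lemma fderiv_apply_eq (x v : Fin 2 → ℝ) : fderiv ℝ f x v = v 0 * pd 0 f x + v 1 * pd 1 f x :=
  dird_eq v x

/-- If a quadratic form in the plane dominates `c` times the Euclidean one, its determinant is
at least `c ^ 2`. -/
lemma sq_le_det {a b e c : ℝ} (hc : 0 ≤ c)
    (h : ∀ v w : ℝ, c * (v ^ 2 + w ^ 2) ≤ a * v ^ 2 + 2 * b * v * w + e * w ^ 2) :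
    c ^ 2 ≤ a * e - b * b := by
  have h1 := h 1 0
  have h2 := h 0 1
  have h3 : discrim (a - c) (2 * b) (e - c) ≤ 0 := discrim_le_zero fun v => by
    linarith [h v 1]
  rw [discrim] at h3
  nlinarith

lemma lt_pow_four_of_one_div_lt {D h b : ℝ} (hD : 0 < D) (hh : 0 < h)
    (H : 1 / (D ^ (-(1 / 4) : ℝ) * h) < b) : D < (b * h) ^ 4 := by
  have hr : 0 < D ^ (-(1 / 4) : ℝ) := Real.rpow_pos_of_pos hD _
  rw [div_lt_iff₀ (by positivity)] at H
  have e : (D ^ (-(1 / 4) : ℝ)) ^ 4 = D⁻¹ := by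
    rw [← Real.rpow_natCast, ← Real.rpow_mul hD.le]
    norm_num
    exact Real.rpow_neg_one D
  have h4 : 1 < (b * (D ^ (-(1 / 4) : ℝ) * h)) ^ 4 := one_lt_pow₀ H (by norm_num)
  have e4 : (b * (D ^ (-(1 / 4) : ℝ) * h)) ^ 4 = D⁻¹ * (b * h) ^ 4 := by rw [← e]; ring
  rw [e4, inv_mul_eq_div, one_lt_div hD] at h4
  exact h4

/-- A uniform positive lower bound for `d + u`. -/
lemma SClass.support_lower_bound {b d : ℝ} (hΩ : NormalizedDomain Ω) (hS : SClass Ω C f)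
    (hC : 0 < C) (hb : 0 < b)
    (hpos : ∀ x ∈ Ω, 0 < d + (x 0 * pd 0 f x + x 1 * pd 1 f x) - f x)
    (hρ : ∀ x ∈ Ω, 1 / (rho f x * (d + (x 0 * pd 0 f x + x 1 * pd 1 f x) - f x)) < b)
    (hx : x ∈ Ω) :
    4 * min (C / 4) (1 / (64 * b ^ 2)) ≤ d + (x 0 * pd 0 f x + x 1 * pd 1 f x) - f x := by
  obtain ⟨c, hc⟩ : ∃ c, c = min (C / 4) (1 / (64 * b ^ 2)) := ⟨_, rfl⟩
  have hc0 : 0 < c := by rw [hc]; positivity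
  have hc1 : c ≤ C - f 0 := hc ▸ (min_le_left _ _).trans (hS.zero_value_le hΩ)
  have hc2 : c * (64 * b ^ 2) ≤ 1 := by
    rw [← le_div_iff₀ (by positivity), hc]
    exact min_le_right _ _
  have hc00 : 0 < C - f 0 := hc0.trans_le hc1
  have hbase : d - f 0 ≤ d + (x 0 * pd 0 f x + x 1 * pd 1 f x) - f x := by
    have t := tangent_le hΩ.1 hΩ.2.1 hS.1 hS.2.1 hx hΩ.zero_mem
    rw [zero_sub, map_neg, fderiv_apply_eq] at t
    linarith
  rw [← hc]
  refine le_trans ?_ hbase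
  by_contra! hlt
  obtain ⟨g₀, hg₀⟩ : ∃ g, g = pd 0 f 0 := ⟨_, rfl⟩
  obtain ⟨g₁, hg₁⟩ : ∃ g, g = pd 1 f 0 := ⟨_, rfl⟩
  have tan0 : ∀ y ∈ closure Ω, f 0 + (y 0 * g₀ + y 1 * g₁) ≤ f y := fun y hy => by
    have t := hS.tangent_le_closure hΩ hΩ.zero_mem hy
    rwa [sub_zero, fderiv_apply_eq, ← hg₀, ← hg₁] at t
  obtain ⟨t, ht⟩ : ∃ t, t = 1 - c / (C - f 0) := ⟨_, rfl⟩
  have htc : t * (C - f 0) = C - f 0 - c := by rw [ht]; field_simp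
  have ht0 : 0 ≤ t := by
    rw [ht, sub_nonneg]; exact (div_le_one hc00).2 hc1
  obtain ⟨W, hW⟩ : ∃ W : (Fin 2 → ℝ) → ℝ, W = fun y => t * (g₀ * y 0 + g₁ * y 1) +
      c / 2 * ((1 * y 0 + 0 * y 1) * (1 * y 0 + 0 * y 1)
        + (0 * y 0 + 1 * y 1) * (0 * y 0 + 1 * y 1)) - f y := ⟨_, rfl⟩
  have hWc : ContinuousOn W (closure Ω) := by
    rw [hW]
    exact ContinuousOn.sub (by fun_prop) hS.2.2.2.1
  obtain ⟨z, hz, hmax⟩ := hΩ.isCompact_closure.exists_isMaxOn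
    ⟨0, subset_closure hΩ.zero_mem⟩ hWc
  have hball : ∀ y ∈ closure Ω, y 0 ^ 2 + y 1 ^ 2 ≤ 1 := fun y hy =>
    le_on_closure (f := fun y : Fin 2 → ℝ => y 0 ^ 2 + y 1 ^ 2) (g := fun _ => (1 : ℝ))
      (fun y hy => by
        have h : y 0 ^ 2 + y 1 ^ 2 < 1 ^ 2 := hΩ.2.2.2 hy
        linarith) (by fun_prop) (by fun_prop) hy
  have hzΩ : z ∈ Ω := by
    by_contra hzΩ
    have hfz := hS.2.2.2.2 z (by rw [hΩ.1.frontier_eq]; exact ⟨hz, hzΩ⟩)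
    have h0 : W 0 ≤ W z := hmax (subset_closure hΩ.zero_mem)
    simp only [hW, Pi.zero_apply, hfz] at h0
    have h1 := mul_le_mul_of_nonneg_left (tan0 z hz) ht0
    rw [hfz] at h1
    nlinarith [hball z hz]
  have hloc : IsLocalMax W z := by
    filter_upwards [hΩ.1.mem_nhds hzΩ] with y hy using hmax (subset_closure hy)
  have jet := fun v : Fin 2 → ℝ => ((((HasJet.linear hΩ.1 hzΩ v g₀ g₁).const_mul t).add
    ((((HasJet.linear hΩ.1 hzΩ v 1 0).mul (HasJet.linear hΩ.1 hzΩ v 1 0)).add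
      ((HasJet.linear hΩ.1 hzΩ v 0 1).mul (HasJet.linear hΩ.1 hzΩ v 0 1))).const_mul (c / 2))).sub
    (HasJet.of_smooth hΩ.1 hzΩ hS.1 v)).congr (ψ := W) (fun y _ => by rw [hW])
  have first : ∀ v, t * (g₀ * v 0 + g₁ * v 1) + c * (z 0 * v 0 + z 1 * v 1) = dird v f z :=
    fun v => by
      linear_combination (jet v).fst.symm.trans (dird_eq_zero_of_isLocalMax hloc v)
  have second : ∀ v w : ℝ, c * (v ^ 2 + w ^ 2) ≤ pd 0 (pd 0 f) z * v ^ 2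
      + 2 * pd 0 (pd 1 f) z * v * w + pd 1 (pd 1 f) z * w ^ 2 := fun v w => by
    have e := (jet ![v, w]).snd.symm.trans_le
      (dird_dird_nonpos_of_isLocalMax hΩ.1 (jet ![v, w]).smooth hzΩ hloc ![v, w])
    rw [dird_dird_eq hΩ.1 hS.1 ![v, w] ![v, w] hzΩ] at e
    simp only [Matrix.cons_val_zero, Matrix.cons_val_one] at e
    linear_combination e
  have hdet := sq_le_det hc0.le second
  obtain ⟨h, hh⟩ : ∃ h, h = d + (z 0 * pd 0 f z + z 1 * pd 1 f z) - f z := ⟨_, rfl⟩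
  have hh0 : 0 < h := hh ▸ hpos z hzΩ
  have hhle : h ≤ 8 * c := by
    have e := first z
    rw [dird_eq] at e
    have e1 := tan0 z hz
    have e2 := (tan0 _ (subset_closure (hΩ.neg_third_mem hzΩ))).trans
      (hS.lt hΩ (hΩ.neg_third_mem hzΩ)).le
    simp only [Pi.smul_apply, smul_eq_mul] at e2
    have e3 : (1 - t) * (-(z 0 * g₀ + z 1 * g₁)) ≤ c * 3 := by
      have : c * 3 = (1 - t) * (3 * (C - f 0)) := by linear_combination 3 * htc
      rw [this]
      refine mul_le_mul_of_nonneg_left (by linarith) ?_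
      rw [ht]
      have : 0 ≤ c / (C - f 0) := by positivity
      linarith
    have e4 := mul_le_mul_of_nonneg_left (hball z hz) hc0.le
    rw [hh]
    linarith
  have hlt' := hρ z hzΩ
  rw [rho_eq hΩ.1 hS.1 hzΩ, ← hh] at hlt'
  have h4 := lt_pow_four_of_one_div_lt (hdet_pos hΩ.1 hS.1 hS.2.1 hzΩ) hh0 hlt'
  have h5 : c ^ 2 < ((b * h) ^ 2) ^ 2 := by
    rw [← pow_mul]
    exact lt_of_le_of_lt hdet h4
  have h6 : c < (b * h) ^ 2 := lt_of_pow_lt_pow_left₀ 2 (by positivity) h5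
  have h7 : (b * h) ^ 2 ≤ (b * (8 * c)) ^ 2 := by gcongr
  have h8 : (b * (8 * c)) ^ 2 = c * (64 * b ^ 2) * c := by ring
  have h9 : c * (64 * b ^ 2) * c ≤ 1 * c := mul_le_mul_of_nonneg_right hc2 hc0.le
  linarith

end Convexity

section MaximumPrinciple

variable {Ω : Set (Fin 2 → ℝ)} {f : (Fin 2 → ℝ) → ℝ} {C β b d : ℝ} {x : Fin 2 → ℝ}

/-- The function `d + u ∘ ∇f`, where `u` is the Legendre transform of `f` relative to `0`. -/
noncomputable def supportFn (d : ℝ) (f : (Fin 2 → ℝ) → ℝ) (x : Fin 2 → ℝ) : ℝ :=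
  d + (x 0 * pd 0 f x + x 1 * pd 1 f x) - f x

lemma contDiffOn_supportFn (hΩ : IsOpen Ω) (hf : ContDiffOn ℝ (⊤ : ℕ∞) f Ω) (d : ℝ) :
    ContDiffOn ℝ (⊤ : ℕ∞) (supportFn d f) Ω := by
  have h1 := fun i => contDiffOn_pd hΩ hf i
  have hx : ∀ i, ContDiffOn ℝ (⊤ : ℕ∞) (fun y : Fin 2 → ℝ => y i) Ω := fun i => by fun_prop
  exact (contDiffOn_const.add (((hx 0).mul (h1 0)).add ((hx 1).mul (h1 1)))).sub hf

/-- The weight `(ρ (d + u)) ^ (-α)`. -/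
noncomputable def weight (α d : ℝ) (f : (Fin 2 → ℝ) → ℝ) (x : Fin 2 → ℝ) : ℝ :=
  Real.exp (-(α * (logRho f x + Real.log (supportFn d f x))))

lemma weight_eq {α : ℝ} (hρ : 0 < rho f x) (hh : 0 < supportFn d f x) :
    weight α d f x = (rho f x ^ α * supportFn d f x ^ α)⁻¹ := by
  rw [weight, logRho, Real.rpow_def_of_pos hρ, Real.rpow_def_of_pos hh, ← Real.exp_add,
    ← Real.exp_neg]
  ring_nf

lemma weight_le {α : ℝ} (hα : 0 < α) (hρ : 0 < rho f x) (hh : 0 < supportFn d f x)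
    (h : 1 / (rho f x * supportFn d f x) < b) : weight α d f x ≤ b ^ α := by
  rw [weight_eq hρ hh, ← Real.mul_rpow hρ.le hh.le, ← Real.inv_rpow (by positivity)]
  rw [one_div] at h
  exact Real.rpow_le_rpow (by positivity) h.le hα.le

/-- The constant in the bound for the test function on a sublevel set. -/
noncomputable def testBound (α μ C d b δ : ℝ) (k : ℕ) : ℝ :=
  C ^ (k - 1) * (2 * k * (1 + (C + d) / δ) + 2 * k + 2 * α * (C / δ) + 300 * μ + 1) * b ^ α

/-- The test function is bounded on sublevel sets. -/
lemma test_function_le {α μ δ C' : ℝ} {k : ℕ} (hΩ : NormalizedDomain Ω) (hS : SClass Ω C f)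
    (hpde : PDE2 f β Ω) (hC : 0 < C) (hβ : 0 < β) (hb : 0 < b) (hd : 0 < d) (hδ : 0 < δ)
    (hδh : ∀ x ∈ Ω, δ ≤ supportFn d f x)
    (hρ : ∀ x ∈ Ω, 1 / (rho f x * supportFn d f x) < b)
    (hα : 16 + 608 / β ≤ α) (hk : 8 * α ≤ k) (hμ : μ = (k : ℝ) ^ 2 / (16 * α))
    (hC' : C' < C) (hx : x ∈ Ω) (hxC : f x ≤ C') :
    ((C' - f x) ^ k * gradSq f (logRho f) x + μ * ((C' - f x) ^ (k - 2) * gradSq f f x))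
      * weight α d f x ≤ testBound α μ C d b δ k := by
  have hα16 : 16 < α := by
    have : 0 < 608 / β := by positivity
    linarith
  have hα0 : 0 < α := by linarith
  have hμ0 : 0 ≤ μ := by rw [hμ]; positivity
  have hk3 : 3 ≤ k := by
    have : (3 : ℝ) ≤ k := by linarith
    exact_mod_cast this
  have hB : 0 ≤ testBound α μ C d b δ k := by rw [testBound]; positivity
  have hlS := contDiffOn_logRho hΩ.1 hS.1 hS.2.1
  have hgS := (contDiffOn_gradSq hΩ.1 hS.1 hS.2.1 hlS).continuousOn
  have hgf := (contDiffOn_gradSq hΩ.1 hS.1 hS.2.1 hS.1).continuousOn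
  have hfc := hS.1.continuousOn
  have hh0 : ∀ y ∈ Ω, 0 < supportFn d f y := fun y hy => hδ.trans_le (hδh y hy)
  obtain ⟨Z, hZ⟩ : ∃ Z : (Fin 2 → ℝ) → ℝ, Z = fun y => ((C' - f y) ^ k * gradSq f (logRho f) y
      + μ * ((C' - f y) ^ (k - 2) * gradSq f f y)) * weight α d f y := ⟨_, rfl⟩
  have hZc : ContinuousOn Z Ω := by
    have hl : ContinuousOn (fun y => Real.log (supportFn d f y)) Ω :=
      (contDiffOn_supportFn hΩ.1 hS.1 d).continuousOn.log fun y hy => (hh0 y hy).ne'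
    have hlc := hlS.continuousOn
    simp only [hZ, weight]
    fun_prop
  obtain ⟨K, hK⟩ : ∃ K, K = closure Ω ∩ f ⁻¹' Set.Iic C' := ⟨_, rfl⟩
  have hKc : IsCompact K := hK ▸ hΩ.isCompact_closure.of_isClosed_subset
    (hS.2.2.2.1.preimage_isClosed_of_isClosed isClosed_closure isClosed_Iic) Set.inter_subset_left
  have hKΩ : K ⊆ Ω := fun y hy => by
    rw [hK] at hy
    by_contra hyΩ
    have := hS.2.2.2.2 y (by rw [hΩ.1.frontier_eq]; exact ⟨hy.1, hyΩ⟩)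
    exact absurd hy.2 (not_le.2 (this ▸ hC'))
  have hxK : x ∈ K := hK ▸ ⟨subset_closure hx, hxC⟩
  obtain ⟨w, hwK, hmax⟩ := hKc.exists_isMaxOn ⟨x, hxK⟩ (hZc.mono hKΩ)
  have hxw : Z x ≤ Z w := hmax hxK
  suffices Z w ≤ testBound α μ C d b δ k by
    rw [hZ] at hxw this
    exact hxw.trans this
  by_cases hZw : Z w ≤ 0
  · exact hZw.trans hB
  rw [not_le] at hZw
  have hwΩ := hKΩ hwK
  have hwC : f w < C' := by
    refine lt_of_le_of_ne (hK ▸ hwK : w ∈ closure Ω ∩ f ⁻¹' Set.Iic C').2 fun e => ?_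
    simp only [hZ, e, sub_self] at hZw
    rw [zero_pow (by lia), zero_pow (by lia)] at hZw
    simp at hZw
  have hZP : ∀ y, f y < C' → Z y = (C' - f y) ^ k * (gradSq f (logRho f) y
      + μ * (gradSq f f y * ((C' - f y)⁻¹ * (C' - f y)⁻¹))) * weight α d f y := fun y hy => by
    have hne : C' - f y ≠ 0 := (sub_pos.2 hy).ne'
    obtain ⟨j, rfl⟩ : ∃ j, k = j + 2 := ⟨k - 2, by lia⟩
    simp only [hZ, Nat.add_sub_cancel]
    field_simp
    ring
  obtain ⟨P, hP⟩ : ∃ P : (Fin 2 → ℝ) → ℝ, P = fun y => gradSq f (logRho f) y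
      + μ * (gradSq f f y * ((C' - f y)⁻¹ * (C' - f y)⁻¹)) := ⟨_, rfl⟩
  have hZP' : ∀ y, f y < C' → Z y = (C' - f y) ^ k * P y * weight α d f y := fun y hy => by
    rw [hZP y hy, hP]
  have hV : IsOpen (Ω ∩ f ⁻¹' Set.Iio C') := hfc.isOpen_inter_preimage hΩ.1 isOpen_Iio
  have hPc : ContinuousOn P (Ω ∩ f ⁻¹' Set.Iio C') := by
    have hinv : ContinuousOn (fun y => (C' - f y)⁻¹) (Ω ∩ f ⁻¹' Set.Iio C') :=
      (continuousOn_const.sub (hfc.mono Set.inter_subset_left)).inv₀ fun y hy =>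
        (sub_pos.2 hy.2).ne'
    have h1 := hgS.mono (Set.inter_subset_left (t := f ⁻¹' Set.Iio C'))
    have h2 := hgf.mono (Set.inter_subset_left (t := f ⁻¹' Set.Iio C'))
    rw [hP]
    fun_prop
  obtain ⟨U, hUdef⟩ : ∃ U, U = (Ω ∩ f ⁻¹' Set.Iio C') ∩ P ⁻¹' Set.Ioi 0 := ⟨_, rfl⟩
  have hU : IsOpen U := hUdef ▸ hPc.isOpen_inter_preimage hV isOpen_Ioi
  have hUΩ : U ⊆ Ω := fun y hy => by rw [hUdef] at hy; exact hy.1.1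
  have hUC : ∀ y ∈ U, f y < C' := fun y hy => by rw [hUdef] at hy; exact hy.1.2
  have hUP : ∀ y ∈ U, 0 < P y := fun y hy => by rw [hUdef] at hy; exact hy.2
  have hw0 : ∀ y, 0 < weight α d f y := fun y => Real.exp_pos _
  have hzw : 0 < C' - f w := sub_pos.2 hwC
  have hPw : 0 < P w := by
    rw [hZP' w hwC] at hZw
    exact pos_of_mul_pos_right (pos_of_mul_pos_left hZw (hw0 w).le) (by positivity)
  have hwU : w ∈ U := hUdef ▸ ⟨⟨hwΩ, hwC⟩, hPw⟩
  have hlog : ∀ y ∈ U, Real.log (Z y) = Real.log (P y) + k * Real.log (C' - f y)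
      - α * (logRho f y + Real.log (supportFn d f y)) := fun y hy => by
    have hz : 0 < C' - f y := sub_pos.2 (hUC y hy)
    rw [hZP' y (hUC y hy), Real.log_mul (mul_ne_zero (by positivity) (hUP y hy).ne') (hw0 y).ne',
      Real.log_mul (by positivity) (hUP y hy).ne', Real.log_pow, weight, Real.log_exp]
    ring
  have hZU : ∀ y ∈ U, 0 < Z y := fun y hy => by
    have hz : 0 < C' - f y := sub_pos.2 (hUC y hy)
    rw [hZP' y (hUC y hy)]
    exact mul_pos (mul_pos (by positivity) (hUP y hy)) (hw0 y)
  have hloc : IsLocalMax (fun y => Real.log (P y) + k * Real.log (C' - f y)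
      - α * (logRho f y + Real.log (supportFn d f y))) w := by
    filter_upwards [hU.mem_nhds hwU] with y hy
    rw [← hlog y hy, ← hlog w hwU]
    refine Real.log_le_log (hZU y hy) (hmax ?_)
    rw [hK]
    exact ⟨subset_closure (hUΩ hy), (hUC y hy).le⟩
  have hhw := hδh w hwΩ
  have hfw := hS.nonneg hΩ hwΩ
  have key : P w ≤ (2 * k * (1 + (C + d) / δ) + 2 * k + 2 * α * (C / δ) + 300 * μ + 1)
      * (C' - f w)⁻¹ := by
    rw [hP] at hloc hUP ⊢
    refine estimate_at_local_max (h := supportFn d f) hΩ.1 hS.1 hS.2.1 hpde hU hUΩ hwU (fun y _ => rfl)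
      (fun y hy => sub_pos.2 (hUC y hy)) (fun y hy => hh0 y (hUΩ hy)) hUP hloc hβ hα hk hμ
      (by positivity) (by positivity) ?_ ?_
    · have e : C + d ≤ (C + d) / δ * supportFn d f w := by
        rw [div_mul_eq_mul_div, le_div_iff₀ hδ]
        exact mul_le_mul_of_nonneg_left hhw (by positivity)
      rw [abs_le]
      constructor <;> linarith
    · have e1 : 1 / supportFn d f w ≤ 1 / δ := one_div_le_one_div_of_le hδ hhw
      have e2 : 1 ≤ C * (C' - f w)⁻¹ := by
        rw [← div_eq_mul_inv, one_le_div hzw]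
        linarith
      calc 1 / supportFn d f w ≤ 1 / δ * 1 := by rwa [mul_one]
        _ ≤ 1 / δ * (C * (C' - f w)⁻¹) := mul_le_mul_of_nonneg_left e2 (by positivity)
        _ = C / δ * (C' - f w)⁻¹ := by ring
  rw [hZP' w hwC, testBound]
  have hM : 0 ≤ 2 * k * (1 + (C + d) / δ) + 2 * k + 2 * α * (C / δ) + 300 * μ + 1 := by positivity
  refine mul_le_mul ?_ (weight_le hα0 (rho_pos hΩ.1 hS.1 hS.2.1 hwΩ) (hh0 w hwΩ) (hρ w hwΩ))
    (hw0 w).le (by positivity)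
  obtain ⟨j, rfl⟩ : ∃ j, k = j + 1 := ⟨k - 1, by lia⟩
  have hzC : C' - f w ≤ C := by linarith
  rw [Nat.add_sub_cancel]
  calc (C' - f w) ^ (j + 1) * P w ≤ (C' - f w) ^ (j + 1) * (_ * (C' - f w)⁻¹) :=
        mul_le_mul_of_nonneg_left key (by positivity)
    _ = (C' - f w) ^ j * _ := by rw [pow_succ]; field_simp
    _ ≤ C ^ j * _ := mul_le_mul_of_nonneg_right (by gcongr) hM

/-- The test function estimate up to the boundary. -/
lemma pointwise_bound {α μ δ : ℝ} {k : ℕ} (hΩ : NormalizedDomain Ω) (hS : SClass Ω C f)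
    (hpde : PDE2 f β Ω) (hC : 0 < C) (hβ : 0 < β) (hb : 0 < b) (hd : 0 < d) (hδ : 0 < δ)
    (hδh : ∀ x ∈ Ω, δ ≤ supportFn d f x)
    (hρ : ∀ x ∈ Ω, 1 / (rho f x * supportFn d f x) < b)
    (hα : 16 + 608 / β ≤ α) (hk : 8 * α ≤ k) (hμ : μ = (k : ℝ) ^ 2 / (16 * α)) (hx : x ∈ Ω) :
    (C - f x) ^ k * gradSq f (logRho f) x * weight α d f x
        ≤ 2 ^ k * testBound α μ C d b δ k ∧
      (C - f x) ^ (k - 2) * gradSq f f x * weight α d f x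
        ≤ 2 ^ (k - 2) / μ * testBound α μ C d b δ k := by
  have hlt := hS.lt hΩ hx
  have hz : 0 < C - f x := sub_pos.2 hlt
  have e := test_function_le (C' := (C + f x) / 2) hΩ hS hpde hC hβ hb hd hδ hδh hρ hα hk hμ
    (by linarith) hx (by linarith)
  have hα16 : 16 < α := by
    have : 0 < 608 / β := by positivity
    linarith
  have hk0 : (0 : ℝ) < k := by linarith
  have hμ0 : 0 < μ := by rw [hμ]; positivity
  have g1 : 0 ≤ gradSq f (logRho f) x := gradSq_nonneg (hS.2.1 x hx)
  have g2 : 0 ≤ gradSq f f x := gradSq_nonneg (hS.2.1 x hx)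
  have hw : 0 < weight α d f x := Real.exp_pos _
  have hz2 : (C + f x) / 2 - f x = (C - f x) / 2 := by ring
  rw [hz2, div_pow, div_pow] at e
  have n1 : 0 ≤ (C - f x) ^ k / 2 ^ k * gradSq f (logRho f) x * weight α d f x := by positivity
  have n2 : 0 ≤ μ * ((C - f x) ^ (k - 2) / 2 ^ (k - 2) * gradSq f f x) * weight α d f x := by
    positivity
  constructor
  · have : (C - f x) ^ k / 2 ^ k * gradSq f (logRho f) x * weight α d f x
        ≤ testBound α μ C d b δ k := by linarith
    calc _ = 2 ^ k * ((C - f x) ^ k / 2 ^ k * gradSq f (logRho f) x * weight α d f x) := by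
          field_simp
      _ ≤ _ := mul_le_mul_of_nonneg_left this (by positivity)
  · have : μ * ((C - f x) ^ (k - 2) / 2 ^ (k - 2) * gradSq f f x) * weight α d f x
        ≤ testBound α μ C d b δ k := by linarith
    calc _ = 2 ^ (k - 2) / μ *
          (μ * ((C - f x) ^ (k - 2) / 2 ^ (k - 2) * gradSq f f x) * weight α d f x) := by
          field_simp
      _ ≤ _ := mul_le_mul_of_nonneg_left this (by positivity)

end MaximumPrinciple

/-- The function `exp (-1 / z)` vanishes to infinite order at `0`. -/
lemma exp_neg_one_div_le {z : ℝ} (hz : 0 < z) (n : ℕ) :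
    Real.exp (-1 / z) ≤ n.factorial * z ^ n := by
  have h := Real.pow_div_factorial_le_exp (1 / z) (by positivity) n
  rw [neg_div, Real.exp_neg]
  refine inv_le_of_inv_le₀ (by positivity) (le_trans (le_of_eq ?_) h)
  rw [one_div, inv_pow, mul_inv, div_eq_mul_inv, mul_comm]

/-- Lemma 3.5: with `f ∈ 𝒮(Ω,C)` solving PDE (1.2), `β > 0`, and
`1/(ρ(d+u)) < b` on `Ω`, there exist positive constants `α, N, m` with
`𝒜 ≤ d₂` and `𝒟 ≤ d₂`, `d₂` depending only on `α, b, β, C` (and `d`). -/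
theorem statement11 (C β b d : ℝ) (hC : 0 < C) (hβ : 0 < β) (hb : 0 < b) (hd : 0 < d) :
    ∃ α N m : ℝ, 0 < α ∧ 0 < N ∧ 0 < m ∧
      ∃ d₂ : ℝ, 0 < d₂ ∧
        ∀ (Ω : Set (Fin 2 → ℝ)) (f u : (Fin 2 → ℝ) → ℝ),
          NormalizedDomain Ω → SClass Ω C f → PDE2 f β Ω → LegendreOf Ω f u →
          (∀ x ∈ Ω, 0 < d + u (gradv f x)) →
          (∀ x ∈ Ω, 1 / (rho f x * (d + u (gradv f x))) < b) →
          Aval Ω C m α d f u ≤ d₂ ∧ Dval Ω C m α N d f u ≤ d₂ := by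
  obtain ⟨α, hα⟩ : ∃ α, α = 16 + 608 / β := ⟨_, rfl⟩
  obtain ⟨k, hk⟩ : ∃ k : ℕ, 8 * α ≤ k := ⟨_, Nat.le_ceil _⟩
  obtain ⟨μ, hμ⟩ : ∃ μ, μ = (k : ℝ) ^ 2 / (16 * α) := ⟨_, rfl⟩
  obtain ⟨δ, hδ⟩ : ∃ δ, δ = 4 * min (C / 4) (1 / (64 * b ^ 2)) := ⟨_, rfl⟩
  have hα0 : 0 < α := by rw [hα]; positivity
  have hα16 : 16 ≤ α := by
    have : 0 < 608 / β := by positivity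
    linarith
  have hk0 : (0 : ℝ) < k := by linarith
  have hk2 : 2 ≤ k := by
    have : (2 : ℝ) ≤ k := by linarith
    exact_mod_cast this
  have hμ0 : 0 < μ := by rw [hμ]; positivity
  have hδ0 : 0 < δ := by rw [hδ]; positivity
  have hB : 0 ≤ testBound α μ C d b δ k := by rw [testBound]; positivity
  obtain ⟨A, hA⟩ : ∃ A, A = k.factorial * (2 ^ k * testBound α μ C d b δ k) := ⟨_, rfl⟩
  obtain ⟨D, hD⟩ : ∃ D, D = Real.exp 1 * ((k + 2).factorial *
    (2 ^ (k - 2) / μ * testBound α μ C d b δ k)) := ⟨_, rfl⟩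
  have hA0 : 0 ≤ A := by rw [hA]; positivity
  have hD0 : 0 ≤ D := by rw [hD]; positivity
  refine ⟨α, 1, 1, hα0, one_pos, one_pos, A + D + 1, by positivity, ?_⟩
  intro Ω f u hΩ hS hpde hu hpos hρ
  have hs : ∀ x ∈ Ω, d + u (gradv f x) = supportFn d f x := fun x hx => by
    rw [hu x hx, Fin.sum_univ_two, supportFn, gradv, gradv]
    ring
  have hpos' : ∀ x ∈ Ω, 0 < supportFn d f x := fun x hx => hs x hx ▸ hpos x hx
  have hρ' : ∀ x ∈ Ω, 1 / (rho f x * supportFn d f x) < b := fun x hx => hs x hx ▸ hρ x hx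
  have hδh : ∀ x ∈ Ω, δ ≤ supportFn d f x := fun x hx =>
    hδ ▸ hS.support_lower_bound hΩ hC hb hpos' hρ' hx
  have hbd := fun {x} (hx : x ∈ Ω) =>
    pointwise_bound hΩ hS hpde hC hβ hb hd hδ0 hδh hρ' hα.ge hk hμ hx
  have hwt : ∀ x ∈ Ω, weight α d f x = (rho f x ^ α * (d + u (gradv f x)) ^ α)⁻¹ := fun x hx => by
    rw [hs x hx, weight_eq (rho_pos hΩ.1 hS.1 hS.2.1 hx) (hpos' x hx)]
  have hz : ∀ x ∈ Ω, 0 < C - f x := fun x hx => sub_pos.2 (hS.lt hΩ hx)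
  have hw0 : ∀ x, 0 < weight α d f x := fun x => Real.exp_pos _
  have hAx : ∀ x ∈ Ω, Real.exp (-1 / (C - f x)) * Phi f x /
      (rho f x ^ α * (d + u (gradv f x)) ^ α) ≤ A := fun x hx => by
    have g := gradSq_nonneg (h := logRho f) (hS.2.1 x hx)
    rw [div_eq_mul_inv, ← hwt x hx, Phi_eq hΩ.1 hS.1 hS.2.1 hx, hA]
    calc _ ≤ k.factorial * (C - f x) ^ k * gradSq f (logRho f) x * weight α d f x := by
          gcongr
          · exact (hw0 x).le
          · exact exp_neg_one_div_le (hz x hx) k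
      _ = k.factorial * ((C - f x) ^ k * gradSq f (logRho f) x * weight α d f x) := by ring
      _ ≤ _ := mul_le_mul_of_nonneg_left (hbd hx).1 (by positivity)
  have hAx0 : ∀ x ∈ Ω, 0 ≤ Real.exp (-1 / (C - f x)) * Phi f x /
      (rho f x ^ α * (d + u (gradv f x)) ^ α) := fun x hx => by
    have g := gradSq_nonneg (h := logRho f) (hS.2.1 x hx)
    have := hw0 x
    rw [div_eq_mul_inv, ← hwt x hx, Phi_eq hΩ.1 hS.1 hS.2.1 hx]
    positivity
  have hAv : Aval Ω C 1 α d f u ≤ A :=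
    Real.sSup_le (Set.forall_mem_image.2 hAx) hA0
  have hAv0 : 0 ≤ Aval Ω C 1 α d f u := Real.sSup_nonneg (Set.forall_mem_image.2 hAx0)
  have hK : ∀ x ∈ Ω, Kfun Ω C 1 α 1 d f u x ≤ 1 := fun x hx => by
    rw [Kfun, one_div_mul_eq_div]
    refine div_le_one_of_le₀ (le_csSup ⟨A, ?_⟩ (Set.mem_image_of_mem _ hx)) hAv0
    exact Set.forall_mem_image.2 hAx
  refine ⟨by linarith, le_trans (Real.sSup_le (Set.forall_mem_image.2 fun x hx => ?_) hD0)
    (show D ≤ _ by linarith)⟩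
  have g : 0 ≤ gradSq f f x := gradSq_nonneg (hS.2.1 x hx)
  have hzx := hz x hx
  rw [div_eq_mul_inv, ← hwt x hx, hD, add_comm, Real.exp_add]
  obtain ⟨j, rfl⟩ : ∃ j, k = j + 2 := ⟨k - 2, by lia⟩
  rw [Nat.add_sub_cancel]
  have hbx := (hbd hx).2
  rw [Nat.add_sub_cancel] at hbx
  calc _ ≤ Real.exp 1 * ((j + 2 + 2).factorial * (C - f x) ^ (j + 2 + 2)) *
        (1 / (C - f x) ^ 2) ^ 2 * gradSq f f x * weight α d f x := by
        gcongr
        · exact (hw0 x).le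
        · exact hK x hx
        · exact exp_neg_one_div_le hzx _
    _ = Real.exp 1 * ((j + 2 + 2).factorial *
        ((C - f x) ^ j * gradSq f f x * weight α d f x)) := by
        field_simp
        ring
    _ ≤ _ := by gcongr
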